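/- arXiv:2010.14492 — 2 statements merged into one kernel-verified Lean document; each statement's English description precedes it below -/
import Mathlib

section
/- Let q be a prime power, F the finite field with q elements, n ≥ 2 an integer, and δ ∈ [0,(q-1)/q). The rate R of every linearly recoverable (δ,n)-LRC sequence over F (not necessarily all-disjoint) satisfies R ≤ R̂_1(δ,n) := inf over τ ∈ (0,1) and over pairs (θ,θ') ∈ [0,(q-1)/q]² with τ·θ + (1-τ)·θ' = δ of the quantity τ·R̂_0(θ/2,n) + (1-τ)·R_opt(θ'). -/
open Filter Set

noncomputable section

/-- Minimum (Hamming) distance of a code. -/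
def minDist {K : Type} [DecidableEq K] {ι : Type} [Fintype ι] (C : Set (ι → K)) : ℕ :=
  sInf {d : ℕ | ∃ c ∈ C, ∃ c' ∈ C, c ≠ c' ∧ hammingDist c c' = d}

/-- `Rg` exhibits `C` as a linearly recoverable LRC with locality `n - 1`. -/
def IsLinRecLRC {K : Type} [Field K] {N : ℕ} (C : Set (Fin N → K)) (n : ℕ)
    (Rg : Fin N → Finset (Fin N)) : Prop :=
  ∀ j : Fin N, j ∈ Rg j ∧ (Rg j).card ≤ n ∧
    ∃ a : Fin N → K, (∀ i, i ∉ (Rg j).erase j → a i = 0) ∧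
      ∀ c ∈ C, c j = ∑ i, a i * c i

/-- `λ_q(ω,n)`. -/
def lambdaQ (q : ℕ) (ω : ℝ) (n : ℕ) : ℝ :=
  ⨅ z : Set.Ioc (0:ℝ) 1,
    (-ω * Real.logb q (z : ℝ) - 1 / n +
      (1 / n) * Real.logb q ((1 + ((q:ℝ) - 1) * (z:ℝ)) ^ n + ((q:ℝ) - 1) * (1 - (z:ℝ)) ^ n))

/-- `R_0(ω,n) = (n-1)/n - λ_q(ω,n)`. -/
def R0 (q : ℕ) (ω : ℝ) (n : ℕ) : ℝ := ((n:ℝ) - 1) / n - lambdaQ q ω n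

/-- The inner minimum `min_ϑ Σ_{s∈[n]} π_s·R_0(ϑ_s,s)` over nonnegative vectors `ϑ`
with `Σ_s π_s·ϑ_s = ω`. -/
def innerMin (q n : ℕ) (ω : ℝ) (π : ℕ → ℝ) : ℝ :=
  sInf {t : ℝ | ∃ ϑ : ℕ → ℝ, (∀ s ∈ Finset.Icc 1 n, 0 ≤ ϑ s) ∧
    (∑ s ∈ Finset.Icc 1 n, π s * ϑ s) = ω ∧
    t = ∑ s ∈ Finset.Icc 1 n, π s * R0 q (ϑ s) s}

/-- `R̄_0(ω,n,μ)`. -/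
def Rbar0 (q n : ℕ) (ω μ : ℝ) : ℝ :=
  sSup {r : ℝ | ∃ π : ℕ → ℝ, (∀ s ∈ Finset.Icc 1 n, 0 ≤ π s) ∧
    (∑ s ∈ Finset.Icc 1 n, π s) = 1 ∧
    1 / μ ≤ (∑ s ∈ Finset.Icc 1 n, π s / (s : ℝ)) ∧
    r = innerMin q n ω π}

/-- `R̂_0(ω,n) = max_{ν ∈ [0,(n-1)/(n+1)]} [ ν + (1-ν)·R̄_0(ω/(1-ν), n, ((1-ν)/(1+ν))·n) ]`. -/
def Rhat0 (q n : ℕ) (ω : ℝ) : ℝ :=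
  sSup {r : ℝ | ∃ ν : ℝ, ν ∈ Set.Icc (0:ℝ) (((n:ℝ) - 1) / ((n:ℝ) + 1)) ∧
    r = ν + (1 - ν) * Rbar0 q n (ω / (1 - ν)) (((1 - ν) / (1 + ν)) * n)}

/-- `R_opt(δ')`: the supremum of rates of infinite code sequences over `K` with relative
minimum distance at least `δ'`. -/
def Ropt (K : Type) [Field K] [Fintype K] [DecidableEq K] (q : ℕ) (δ' : ℝ) : ℝ :=
  sSup {R : ℝ | ∃ (N : ℕ → ℕ) (C : ∀ i : ℕ, Set (Fin (N i) → K)),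
    StrictMono N ∧ (∀ i, (C i).Nonempty) ∧
    δ' ≤ liminf (fun i => (minDist (C i) : ℝ) / (N i : ℝ)) atTop ∧
    R = limsup (fun i => Real.logb q ((C i).ncard : ℝ) / (N i : ℝ)) atTop}

open Polynomial in
/-- Mean of the distribution on exponents with weights proportional to `P.coeff j * z ^ j`. -/
def polyMean (P : ℝ[X]) (z : ℝ) : ℝ := (X * derivative P).eval z / P.eval z

open Polynomial in
/-- Variance of the distribution on exponents with weights proportional to
`P.coeff j * z ^ j`. -/
def polyVar (P : ℝ[X]) (z : ℝ) : ℝ :=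
  (X * derivative (X * derivative P)).eval z / P.eval z - polyMean P z ^ 2

open Polynomial in
lemma polyMean_mul (P Q : ℝ[X]) (z : ℝ) (hP : P.eval z ≠ 0) (hQ : Q.eval z ≠ 0) :
    polyMean (P * Q) z = polyMean P z + polyMean Q z := by
  simp only [polyMean, derivative_mul, eval_mul, eval_add, eval_X]
  field_simp

open Polynomial in
lemma polyVar_mul (P Q : ℝ[X]) (z : ℝ) (hP : P.eval z ≠ 0) (hQ : Q.eval z ≠ 0) :
    polyVar (P * Q) z = polyVar P z + polyVar Q z := by
  simp only [polyVar, polyMean, derivative_mul, eval_mul, eval_add, eval_X, derivative_add,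
    derivative_X, eval_one]
  field_simp
  ring

open Polynomial in
lemma polyMean_prod {ι : Type*} (G : Finset ι) (f : ι → ℝ[X]) (z : ℝ)
    (hf : ∀ g ∈ G, (f g).eval z ≠ 0) :
    polyMean (∏ g ∈ G, f g) z = ∑ g ∈ G, polyMean (f g) z := by
  classical
  induction G using Finset.induction_on with
  | empty => simp [polyMean]
  | insert a s ha ih =>
    rw [Finset.prod_insert ha, Finset.sum_insert ha, polyMean_mul, ih]
    · exact fun g hg => hf g (Finset.mem_insert_of_mem hg)
    · exact hf a (Finset.mem_insert_self a s)
    · rw [eval_prod]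
      exact Finset.prod_ne_zero_iff.2 fun g hg => hf g (Finset.mem_insert_of_mem hg)

open Polynomial in
lemma polyVar_prod {ι : Type*} (G : Finset ι) (f : ι → ℝ[X]) (z : ℝ)
    (hf : ∀ g ∈ G, (f g).eval z ≠ 0) :
    polyVar (∏ g ∈ G, f g) z = ∑ g ∈ G, polyVar (f g) z := by
  classical
  induction G using Finset.induction_on with
  | empty => simp [polyVar, polyMean]
  | insert a s ha ih =>
    rw [Finset.prod_insert ha, Finset.sum_insert ha, polyVar_mul, ih]
    · exact fun g hg => hf g (Finset.mem_insert_of_mem hg)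
    · exact hf a (Finset.mem_insert_self a s)
    · rw [eval_prod]
      exact Finset.prod_ne_zero_iff.2 fun g hg => hf g (Finset.mem_insert_of_mem hg)

open Polynomial in
lemma coeff_X_mul_derivative' (P : ℝ[X]) (j : ℕ) :
    (X * derivative P).coeff j = j * P.coeff j := by
  cases j with
  | zero => simp
  | succ j => rw [coeff_X_mul, coeff_derivative]; push_cast; ring

open Polynomial in
lemma eval_X_mul_derivative (P : ℝ[X]) (z : ℝ) (D : ℕ) (hD : P.natDegree < D) :
    (X * derivative P).eval z = ∑ j ∈ Finset.range D, j * P.coeff j * z ^ j := by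
  have h : (X * derivative P).natDegree < D := by
    refine lt_of_le_of_lt (natDegree_le_iff_coeff_eq_zero.2 fun j hj => ?_) hD
    rw [coeff_X_mul_derivative', coeff_eq_zero_of_natDegree_lt hj, mul_zero]
  rw [eval_eq_sum_range' h]
  simp only [coeff_X_mul_derivative']

open Polynomial in
lemma eval_X_mul_derivative_twice (P : ℝ[X]) (z : ℝ) (D : ℕ) (hD : P.natDegree < D) :
    (X * derivative (X * derivative P)).eval z =
      ∑ j ∈ Finset.range D, (j:ℝ) ^ 2 * P.coeff j * z ^ j := by
  have h : (X * derivative P).natDegree < D := by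
    refine lt_of_le_of_lt (natDegree_le_iff_coeff_eq_zero.2 fun j hj => ?_) hD
    rw [coeff_X_mul_derivative', coeff_eq_zero_of_natDegree_lt hj, mul_zero]
  rw [eval_X_mul_derivative _ _ _ h]
  refine Finset.sum_congr rfl fun j _ => ?_
  rw [coeff_X_mul_derivative']
  ring

open Polynomial in
lemma sum_sq_sub_polyMean (P : ℝ[X]) (z : ℝ) (D : ℕ) (hD : P.natDegree < D)
    (hP : P.eval z ≠ 0) :
    ∑ j ∈ Finset.range D, P.coeff j * z ^ j * (j - polyMean P z) ^ 2 =
      polyVar P z * P.eval z := by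
  have h0 := eval_eq_sum_range' hD z
  have h1 := eval_X_mul_derivative P z D hD
  have h2 := eval_X_mul_derivative_twice P z D hD
  have key : ∀ μ : ℝ, ∑ j ∈ Finset.range D, P.coeff j * z ^ j * (j - μ) ^ 2 =
      (X * derivative (X * derivative P)).eval z - 2 * μ * (X * derivative P).eval z
        + μ ^ 2 * P.eval z := by
    intro μ
    rw [h0, h1, h2, Finset.mul_sum, Finset.mul_sum, ← Finset.sum_sub_distrib,
      ← Finset.sum_add_distrib]
    exact Finset.sum_congr rfl fun j _ => by ring
  rw [key]
  simp only [polyVar, polyMean]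
  field_simp
  ring

open Polynomial in
/-- Tail bound of Chebyshev type for a polynomial with nonnegative coefficients. -/
lemma half_eval_le_sum_window (P : ℝ[X]) (z v t : ℝ) (hz : 0 ≤ z) (hP : 0 < P.eval z)
    (hc : ∀ j, 0 ≤ P.coeff j) (hv : polyVar P z ≤ v) (ht : 0 < t) (hvt : 2 * v ≤ t ^ 2) :
    P.eval z / 2 ≤ ∑ j ∈ (Finset.range (P.natDegree + 1)).filter
      (fun j : ℕ => |(j:ℝ) - polyMean P z| ≤ t), P.coeff j * z ^ j := by
  classical
  have hsum := sum_sq_sub_polyMean P z _ (Nat.lt_succ_self P.natDegree) hP.ne'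
  have h0 := eval_eq_sum_range' (Nat.lt_succ_self P.natDegree) z
  rw [← Finset.sum_filter_add_sum_filter_not _
    (fun j : ℕ => |(j:ℝ) - polyMean P z| ≤ t)] at h0
  set A := ∑ j ∈ (Finset.range (P.natDegree + 1)).filter
      (fun j : ℕ => |(j:ℝ) - polyMean P z| ≤ t), P.coeff j * z ^ j
  set B := ∑ j ∈ (Finset.range (P.natDegree + 1)).filter
      (fun j : ℕ => ¬ |(j:ℝ) - polyMean P z| ≤ t), P.coeff j * z ^ j with hB
  have hBt : B * t ^ 2 ≤ polyVar P z * P.eval z := by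
    rw [← hsum, hB, Finset.sum_mul]
    refine (Finset.sum_le_sum fun j hj => ?_).trans
      (Finset.sum_le_sum_of_subset_of_nonneg (Finset.filter_subset _ _) fun j _ _ => ?_)
    · have hj' := (Finset.mem_filter.1 hj).2
      refine mul_le_mul_of_nonneg_left ?_ (mul_nonneg (hc j) (pow_nonneg hz j))
      rw [← sq_abs ((j:ℝ) - polyMean P z)]
      exact pow_le_pow_left₀ ht.le (not_le.1 hj').le 2
    · exact mul_nonneg (mul_nonneg (hc j) (pow_nonneg hz j)) (sq_nonneg _)
  have hvP : polyVar P z * P.eval z ≤ t ^ 2 / 2 * P.eval z :=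
    mul_le_mul_of_nonneg_right (by linarith) hP.le
  have : B ≤ P.eval z / 2 := by
    have ht2 : 0 < t ^ 2 := by positivity
    nlinarith
  change P.eval z = A + B at h0
  linarith

open Polynomial in
/-- The properties of the weight enumerator of a linear code of length at most `n` with at
most `Q` codewords that are needed for the large deviation estimate. -/
structure IsWeightPoly (f : ℝ[X]) (n : ℕ) (Q : ℝ) : Prop where
  coeff_nonneg : ∀ j, 0 ≤ f.coeff j
  coeff_zero : f.coeff 0 = 1
  natDegree_le : f.natDegree ≤ n
  eval_one_le : f.eval 1 ≤ Q

open Polynomial in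
lemma IsWeightPoly.eval_eq {f : ℝ[X]} {n : ℕ} {Q : ℝ} (hf : IsWeightPoly f n Q) (z : ℝ) :
    f.eval z = 1 + ∑ j ∈ Finset.range n, f.coeff (j + 1) * z ^ (j + 1) := by
  rw [eval_eq_sum_range' (Nat.lt_succ_of_le hf.natDegree_le), Finset.sum_range_succ']
  simp [hf.coeff_zero, add_comm]

open Polynomial in
lemma IsWeightPoly.one_le_eval {f : ℝ[X]} {n : ℕ} {Q : ℝ} (hf : IsWeightPoly f n Q) {z : ℝ}
    (hz : 0 ≤ z) : 1 ≤ f.eval z := by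
  rw [hf.eval_eq]
  have := Finset.sum_nonneg fun j (_ : j ∈ Finset.range n) =>
    mul_nonneg (hf.coeff_nonneg (j + 1)) (pow_nonneg hz (j + 1))
  linarith

open Polynomial in
lemma IsWeightPoly.sum_coeff_le {f : ℝ[X]} {n : ℕ} {Q : ℝ} (hf : IsWeightPoly f n Q) :
    ∑ j ∈ Finset.range n, f.coeff (j + 1) ≤ Q := by
  have h := hf.eval_one_le
  rw [hf.eval_eq] at h
  simp only [one_pow, mul_one] at h
  linarith

open Polynomial in
lemma IsWeightPoly.eval_le {f : ℝ[X]} {n : ℕ} {Q : ℝ} (hf : IsWeightPoly f n Q) {z : ℝ}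
    (hz : 0 ≤ z) (hz1 : z ≤ 1) : f.eval z ≤ 1 + Q * z := by
  rw [hf.eval_eq]
  have : ∑ j ∈ Finset.range n, f.coeff (j + 1) * z ^ (j + 1) ≤
      (∑ j ∈ Finset.range n, f.coeff (j + 1)) * z := by
    rw [Finset.sum_mul]
    exact Finset.sum_le_sum fun j _ => mul_le_mul_of_nonneg_left
      (pow_le_of_le_one hz hz1 (Nat.succ_ne_zero j)) (hf.coeff_nonneg _)
  have := mul_le_mul_of_nonneg_right hf.sum_coeff_le hz
  linarith

open Polynomial in
lemma IsWeightPoly.polyMean_le {f : ℝ[X]} {n : ℕ} {Q : ℝ} (hf : IsWeightPoly f n Q) {z : ℝ}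
    (hz : 0 ≤ z) (hz1 : z ≤ 1) : polyMean f z ≤ n * Q * z := by
  have h1 := hf.one_le_eval hz
  rw [polyMean, eval_X_mul_derivative f z (n + 1) (Nat.lt_succ_of_le hf.natDegree_le),
    Finset.sum_range_succ']
  have : ∑ j ∈ Finset.range n, ((j + 1 : ℕ) : ℝ) * f.coeff (j + 1) * z ^ (j + 1) ≤
      n * z * ∑ j ∈ Finset.range n, f.coeff (j + 1) := by
    rw [Finset.mul_sum]
    refine Finset.sum_le_sum fun j hj => ?_
    have hjn : ((j + 1 : ℕ) : ℝ) ≤ n := by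
      exact_mod_cast Finset.mem_range.1 hj
    have h2 := pow_le_of_le_one hz hz1 (Nat.succ_ne_zero j)
    calc ((j + 1 : ℕ) : ℝ) * f.coeff (j + 1) * z ^ (j + 1)
        ≤ n * f.coeff (j + 1) * z :=
          mul_le_mul (mul_le_mul_of_nonneg_right hjn (hf.coeff_nonneg _)) h2
            (pow_nonneg hz _) (mul_nonneg (Nat.cast_nonneg n) (hf.coeff_nonneg _))
      _ = n * z * f.coeff (j + 1) := by ring
  have h3 : (n:ℝ) * z * ∑ j ∈ Finset.range n, f.coeff (j + 1) ≤ n * z * Q :=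
    mul_le_mul_of_nonneg_left hf.sum_coeff_le (by positivity)
  have h4 : 0 ≤ (n:ℝ) * z * Q := le_trans (mul_nonneg (by positivity)
    (Finset.sum_nonneg fun j _ => hf.coeff_nonneg _)) h3
  rw [div_le_iff₀ (by linarith)]
  simp only [Nat.cast_zero, zero_mul, add_zero]
  nlinarith

open Polynomial in
lemma IsWeightPoly.polyVar_le {f : ℝ[X]} {n : ℕ} {Q : ℝ} (hf : IsWeightPoly f n Q) {z : ℝ}
    (hz : 0 ≤ z) : polyVar f z ≤ (n:ℝ) ^ 2 := by
  have h1 := hf.one_le_eval hz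
  have hD := Nat.lt_succ_of_le hf.natDegree_le
  have : (X * derivative (X * derivative f)).eval z / f.eval z ≤ (n:ℝ) ^ 2 := by
    rw [div_le_iff₀ (by linarith), eval_X_mul_derivative_twice f z (n + 1) hD,
      eval_eq_sum_range' hD, Finset.mul_sum]
    refine Finset.sum_le_sum fun j hj => ?_
    have hjn : (j : ℝ) ≤ n := by exact_mod_cast Nat.lt_succ_iff.1 (Finset.mem_range.1 hj)
    rw [mul_assoc]
    exact mul_le_mul_of_nonneg_right (pow_le_pow_left₀ (Nat.cast_nonneg j) hjn 2)
      (mul_nonneg (hf.coeff_nonneg _) (pow_nonneg hz _))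
  rw [polyVar]
  linarith [sq_nonneg (polyMean f z)]

open Polynomial in
lemma coeff_prod_nonneg {ι : Type*} (G : Finset ι) (f : ι → ℝ[X])
    (hf : ∀ g ∈ G, ∀ j, 0 ≤ (f g).coeff j) (j : ℕ) : 0 ≤ (∏ g ∈ G, f g).coeff j := by
  classical
  induction G using Finset.induction_on generalizing j with
  | empty =>
    rw [Finset.prod_empty, coeff_one]
    split_ifs <;> norm_num
  | insert a s ha ih =>
    rw [Finset.prod_insert ha, coeff_mul]
    exact Finset.sum_nonneg fun x _ => mul_nonneg (hf a (Finset.mem_insert_self a s) _)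
      (ih (fun g hg => hf g (Finset.mem_insert_of_mem hg)) _)

open Polynomial in
/-- Exponential lower bound on the low-degree coefficients of a product of weight enumerators,
for relative radius zero. -/
lemma exists_tilt_zero (η Q : ℝ) (n : ℕ) (hη : 0 < η) (hQ : 1 ≤ Q) {ι : Type*} (k : ℕ)
    (G : Finset ι) (f : ι → ℝ[X]) (hGk : G.card ≤ k) (hf : ∀ g ∈ G, IsWeightPoly (f g) n Q) :
    ∃ z : ℝ, 0 < z ∧ z ≤ 1 ∧ Real.log ((∏ g ∈ G, f g).eval z) ≤ η * k := by
  have hQ0 : 0 < Q := by linarith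
  refine ⟨min 1 (η / Q), lt_min one_pos (by positivity), min_le_left _ _, ?_⟩
  set z := min 1 (η / Q)
  have hz : 0 < z := lt_min one_pos (by positivity)
  have hz1 : z ≤ 1 := min_le_left _ _
  have hzQ : Q * z ≤ η := by
    have : z ≤ η / Q := min_le_right _ _
    rw [le_div_iff₀ hQ0] at this
    linarith
  rw [eval_prod, Real.log_prod fun g hg => by
    have := (hf g hg).one_le_eval hz.le
    linarith]
  calc ∑ g ∈ G, Real.log ((f g).eval z) ≤ ∑ g ∈ G, η := by
        refine Finset.sum_le_sum fun g hg => ?_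
        have h1 := (hf g hg).one_le_eval hz.le
        have h2 := (hf g hg).eval_le hz.le hz1
        have h3 := Real.log_le_sub_one_of_pos (show 0 < (f g).eval z by linarith)
        linarith
    _ = G.card * η := by rw [Finset.sum_const, nsmul_eq_mul]
    _ ≤ k * η := mul_le_mul_of_nonneg_right (by exact_mod_cast hGk) hη.le
    _ = η * k := mul_comm _ _

open Polynomial in
/-- Exponential lower bound on the low-degree coefficients of a product of weight enumerators,
for positive relative radius. -/
lemma exists_tilt_pos (ω η Q : ℝ) (n : ℕ) (hω : 0 < ω) (hη : 0 < η) (hQ : 1 ≤ Q)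
    (hn : 1 ≤ n) :
    ∃ ε : ℝ, 0 < ε ∧ ε ≤ ω ∧ ∃ k₀ : ℕ, ∀ k : ℕ, k₀ ≤ k → ∀ (ι : Type)
      (G : Finset ι) (f : ι → ℝ[X]), G.card ≤ k → (∀ g ∈ G, IsWeightPoly (f g) n Q) →
      ∃ z : ℝ, 0 < z ∧ z ≤ 1 ∧
        Real.log ((∏ g ∈ G, f g).eval z) - ω * k * Real.log z ≤ η * k +
          Real.log (∑ j ∈ Finset.range (⌊(ω - ε) * k⌋₊ + 1), (∏ g ∈ G, f g).coeff j) := by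
  have hn' : (1:ℝ) ≤ n := by exact_mod_cast hn
  have hn0 : (0:ℝ) < n := by linarith
  have hQ0 : 0 < Q := by linarith
  set z₀ : ℝ := min 1 (ω / (2 * n * Q)) with hz₀
  have hz₀pos : 0 < z₀ := lt_min one_pos (by positivity)
  have hL : 0 ≤ -Real.log z₀ := by
    have := Real.log_nonpos hz₀pos.le (min_le_left _ _)
    linarith
  set L := -Real.log z₀ with hLdef
  set ε : ℝ := min (ω / 4) (η / (6 * (L + 1))) with hε
  have hε0 : 0 < ε := lt_min (by positivity) (by positivity)
  have hεω : ε ≤ ω / 4 := min_le_left _ _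
  have hεL : 3 * ε * L ≤ η / 2 := by
    have h1 : ε ≤ η / (6 * (L + 1)) := min_le_right _ _
    rw [le_div_iff₀ (by positivity)] at h1
    nlinarith
  refine ⟨ε, hε0, by linarith, max 1 (max ⌈2 * (n:ℝ) ^ 2 / ε ^ 2⌉₊ ⌈2 * Real.log 2 / η⌉₊), ?_⟩
  intro k hk ι G f hGk hf
  have hk1 : (1:ℝ) ≤ k := by exact_mod_cast (le_max_left _ _).trans hk
  have hk2 : 2 * (n:ℝ) ^ 2 / ε ^ 2 ≤ k := Nat.ceil_le.1
    (((le_max_left _ _).trans (le_max_right _ _)).trans hk)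
  have hk3 : 2 * Real.log 2 / η ≤ k := Nat.ceil_le.1
    (((le_max_right _ _).trans (le_max_right _ _)).trans hk)
  have hk0 : (0:ℝ) < k := by linarith
  rw [div_le_iff₀ (by positivity)] at hk2 hk3
  set W := ∏ g ∈ G, f g with hW
  have hfpos : ∀ z : ℝ, 0 ≤ z → ∀ g ∈ G, 0 < (f g).eval z := fun z hz g hg =>
    lt_of_lt_of_le one_pos ((hf g hg).one_le_eval hz)
  have hWpos : ∀ z : ℝ, 0 ≤ z → 0 < W.eval z := fun z hz => by
    rw [hW, eval_prod]
    exact Finset.prod_pos (hfpos z hz)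
  have hWc : ∀ j, 0 ≤ W.coeff j := coeff_prod_nonneg G f fun g hg => (hf g hg).coeff_nonneg
  have hcard : (G.card : ℝ) ≤ k := by exact_mod_cast hGk
  have hmean : ∀ z : ℝ, 0 ≤ z → z ≤ 1 → polyMean W z ≤ k * (n * Q * z) := fun z hz hz1 => by
    rw [hW, polyMean_prod G f z fun g hg => (hfpos z hz g hg).ne']
    refine (Finset.sum_le_sum fun g hg => (hf g hg).polyMean_le hz hz1).trans ?_
    rw [Finset.sum_const, nsmul_eq_mul]
    exact mul_le_mul_of_nonneg_right hcard (by positivity)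
  have hvar : ∀ z : ℝ, 0 ≤ z → polyVar W z ≤ k * (n:ℝ) ^ 2 := fun z hz => by
    rw [hW, polyVar_prod G f z fun g hg => (hfpos z hz g hg).ne']
    refine (Finset.sum_le_sum fun g hg => (hf g hg).polyVar_le hz).trans ?_
    rw [Finset.sum_const, nsmul_eq_mul]
    exact mul_le_mul_of_nonneg_right hcard (by positivity)
  -- a tilting parameter for which the mean is just below the target radius, or `z = 1`
  obtain ⟨z, hz0, hz1, hzz, hzm, hzl⟩ : ∃ z : ℝ, 0 < z ∧ z ≤ 1 ∧ z₀ ≤ z ∧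
      polyMean W z ≤ (ω - 2 * ε) * k ∧ (z = 1 ∨ polyMean W z = (ω - 2 * ε) * k) := by
    by_cases h1 : polyMean W 1 ≤ (ω - 2 * ε) * k
    · exact ⟨1, one_pos, le_rfl, min_le_left _ _, h1, Or.inl rfl⟩
    · have hcont : ContinuousOn (polyMean W) (Set.Icc 0 1) := by
        unfold polyMean
        exact ContinuousOn.div (Polynomial.continuous _).continuousOn
          (Polynomial.continuous _).continuousOn fun z hz => (hWpos z hz.1).ne'
      have hm0 : polyMean W 0 = 0 := by simp [polyMean]
      have hmem : (ω - 2 * ε) * k ∈ Set.Icc (polyMean W 0) (polyMean W 1) := by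
        refine ⟨?_, (not_le.1 h1).le⟩
        rw [hm0]
        exact mul_nonneg (by linarith) hk0.le
      obtain ⟨z, hz, hzeq⟩ := intermediate_value_Icc zero_le_one hcont hmem
      have hzm := hmean z hz.1 hz.2
      have hzz : z₀ ≤ z := by
        refine (min_le_right _ _).trans ?_
        rw [div_le_iff₀ (by positivity)]
        rw [hzeq] at hzm
        have h2 : ω - 2 * ε ≤ n * Q * z := by
          by_contra hlt
          have := mul_lt_mul_of_pos_right (not_le.1 hlt) hk0
          linarith
        linarith
      exact ⟨z, lt_of_lt_of_le hz₀pos hzz, hz.2, hzz, hzeq.le, Or.inr hzeq⟩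
  refine ⟨z, hz0, hz1, ?_⟩
  have hwin := half_eval_le_sum_window W z (k * (n:ℝ) ^ 2) (ε * k) hz0.le (hWpos z hz0.le) hWc
    (hvar z hz0.le) (by positivity) (by nlinarith)
  set S := ∑ j ∈ Finset.range (⌊(ω - ε) * k⌋₊ + 1), W.coeff j with hS
  have hz_rpow : 0 < z ^ ((ω - 3 * ε) * k) := Real.rpow_pos_of_pos hz0 _
  have hle : W.eval z / 2 ≤ z ^ ((ω - 3 * ε) * k) * S := by
    refine hwin.trans ?_
    rw [hS, Finset.mul_sum]
    refine (Finset.sum_le_sum (g := fun j => z ^ ((ω - 3 * ε) * k) * W.coeff j)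
      fun j hj => ?_).trans (Finset.sum_le_sum_of_subset_of_nonneg (fun j hj => ?_) fun j _ _ =>
        mul_nonneg hz_rpow.le (hWc j))
    · have hj' := (abs_le.1 (Finset.mem_filter.1 hj).2).1
      rw [mul_comm]
      refine mul_le_mul_of_nonneg_right ?_ (hWc j)
      rcases hzl with rfl | hzl
      · simp
      · rw [← Real.rpow_natCast]
        exact Real.rpow_le_rpow_of_exponent_ge hz0 hz1 (by rw [hzl] at hj'; linarith)
    · have hj' := (abs_le.1 (Finset.mem_filter.1 hj).2).2
      rw [Finset.mem_range, Nat.lt_succ_iff]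
      exact Nat.le_floor (by linarith)
  have hSpos : 0 < S := by
    by_contra hneg
    have := mul_nonpos_of_nonneg_of_nonpos hz_rpow.le (not_lt.1 hneg)
    have := hWpos z hz0.le
    linarith
  have hlog := Real.log_le_log (half_pos (hWpos z hz0.le)) hle
  rw [Real.log_div (hWpos z hz0.le).ne' two_ne_zero, Real.log_mul hz_rpow.ne' hSpos.ne',
    Real.log_rpow hz0] at hlog
  have hlz : -Real.log z ≤ L := by
    have := Real.log_le_log hz₀pos hzz
    linarith
  have hlz' : 3 * ε * (-Real.log z) ≤ η / 2 :=
    (mul_le_mul_of_nonneg_left hlz (by positivity)).trans hεL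
  have := mul_le_mul_of_nonneg_right hlz' hk0.le
  nlinarith

lemma hammingNorm_cons {K : Type} [Field K] [DecidableEq K] {s : ℕ} (b : K) (y : Fin s → K) :
    hammingNorm (Fin.cons b y : Fin (s + 1) → K) = (if b = 0 then 0 else 1) + hammingNorm y := by
  simp only [hammingNorm, Finset.card_filter, Fin.sum_univ_succ, Fin.cons_zero, Fin.cons_succ]
  split_ifs <;> simp_all

lemma sum_pow_indicator {K : Type} [Field K] [Fintype K] [DecidableEq K] (z : ℝ) :
    ∑ b : K, z ^ (if b = 0 then 0 else 1) = 1 + ((Fintype.card K : ℝ) - 1) * z := by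
  rw [← Finset.add_sum_erase _ _ (Finset.mem_univ (0:K)), if_pos rfl, pow_zero,
    Finset.sum_congr rfl (g := fun _ => z) fun b hb => by
      rw [if_neg (Finset.ne_of_mem_erase hb), pow_one],
    Finset.sum_const, Finset.card_erase_of_mem (Finset.mem_univ _), nsmul_eq_mul,
    Nat.cast_sub (Finset.card_pos.2 ⟨0, Finset.mem_univ _⟩)]
  simp [Finset.card_univ]

/-- Weight enumerator of an affine hyperplane with no zero coefficients. -/
lemma sum_affine_hyperplane_fin {K : Type} [Field K] [Fintype K] [DecidableEq K] (s : ℕ)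
    (h : Fin s → K) (hh : ∀ i, h i ≠ 0) (a : K) (z : ℝ) :
    ∑ x : Fin s → K, (if ∑ i, h i * x i = a then z ^ hammingNorm x else 0) =
      ((1 + ((Fintype.card K : ℝ) - 1) * z) ^ s +
        ((if a = 0 then (Fintype.card K : ℝ) else 0) - 1) * (1 - z) ^ s) / Fintype.card K := by
  have hq : (Fintype.card K : ℝ) ≠ 0 := by exact_mod_cast Fintype.card_ne_zero
  induction s generalizing a with
  | zero =>
    rw [Fintype.sum_unique]
    by_cases ha : a = 0
    · simp [ha, hammingNorm, hq]
    · simp [ha, Ne.symm ha]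
  | succ s ih =>
    rw [← (Fin.consEquiv fun _ => K).sum_comp, Fintype.sum_prod_type]
    have step : ∀ b : K, ∑ y : Fin s → K,
        (if ∑ i, h i * (Fin.consEquiv (fun _ => K) (b, y)) i = a then
          z ^ hammingNorm (Fin.consEquiv (fun _ => K) (b, y)) else 0) =
        z ^ (if b = 0 then 0 else 1) * (((1 + ((Fintype.card K : ℝ) - 1) * z) ^ s +
          ((if b = a / h 0 then (Fintype.card K : ℝ) else 0) - 1) * (1 - z) ^ s)
            / Fintype.card K) := by
      intro b
      have hiff : (b = a / h 0) ↔ (a - h 0 * b = 0) := by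
        rw [eq_div_iff (hh 0), sub_eq_zero, mul_comm, eq_comm]
      simp only [hiff]
      rw [← ih (fun i => h i.succ) (fun i => hh _) (a - h 0 * b), Finset.mul_sum]
      refine Finset.sum_congr rfl fun y _ => ?_
      have hc : (Fin.consEquiv (fun _ => K) (b, y) : Fin (s + 1) → K) = Fin.cons b y := rfl
      rw [hc, hammingNorm_cons, Fin.sum_univ_succ, pow_add]
      simp only [Fin.cons_zero, Fin.cons_succ]
      simp only [← eq_sub_iff_add_eq', mul_ite, mul_zero]
    simp only [step]
    set u := 1 + ((Fintype.card K : ℝ) - 1) * z with hu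
    have hsum : ∑ b : K, z ^ (if b = 0 then 0 else 1) * ((u ^ s +
          ((if b = a / h 0 then (Fintype.card K : ℝ) else 0) - 1) * (1 - z) ^ s)
            / Fintype.card K) =
        (∑ b : K, z ^ (if b = 0 then 0 else 1)) * ((u ^ s - (1 - z) ^ s) / Fintype.card K) +
          ∑ b : K, (if b = a / h 0 then z ^ (if b = 0 then 0 else 1) * (1 - z) ^ s else 0) := by
      rw [Finset.sum_mul, ← Finset.sum_add_distrib]
      refine Finset.sum_congr rfl fun b _ => ?_
      by_cases hb : b = a / h 0
      · simp only [if_pos hb]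
        field_simp
        ring
      · simp only [if_neg hb]
        ring
    rw [hsum, sum_pow_indicator, Finset.sum_ite_eq' Finset.univ (a / h 0),
      if_pos (Finset.mem_univ _), ← hu]
    by_cases ha : a = 0
    · simp only [ha, zero_div, if_true, pow_zero, one_mul]
      field_simp
      rw [hu]
      ring
    · have : a / h 0 ≠ 0 := div_ne_zero ha (hh 0)
      simp only [ha, this, if_false, pow_one]
      field_simp
      rw [hu]
      ring

open Polynomial in
/-- Weight enumerator of the code with the single parity check `h`. -/
def parityPoly {K : Type} [Field K] [Fintype K] [DecidableEq K] {σ : Type} [Fintype σ]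
    [DecidableEq σ] (h : σ → K) : ℝ[X] :=
  ∑ x ∈ Finset.univ.filter (fun x : σ → K => ∑ i, h i * x i = 0), X ^ hammingNorm x

lemma hammingNorm_comp_equiv {K : Type} [Field K] [DecidableEq K] {σ σ' : Type} [Fintype σ]
    [Fintype σ'] (e : σ ≃ σ') (x : σ' → K) : hammingNorm (x ∘ e) = hammingNorm x := by
  simp only [hammingNorm, Finset.card_filter, Function.comp]
  exact e.sum_comp fun i => if x i ≠ 0 then 1 else 0

open Polynomial in
lemma eval_parityPoly {K : Type} [Field K] [Fintype K] [DecidableEq K] {σ : Type} [Fintype σ]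
    [DecidableEq σ] (h : σ → K) (hh : ∀ i, h i ≠ 0) (z : ℝ) :
    (parityPoly h).eval z = ((1 + ((Fintype.card K : ℝ) - 1) * z) ^ Fintype.card σ +
        ((Fintype.card K : ℝ) - 1) * (1 - z) ^ Fintype.card σ) / Fintype.card K := by
  set e := Fintype.equivFin σ
  have := sum_affine_hyperplane_fin (Fintype.card σ) (fun i => h (e.symm i)) (fun i => hh _) 0 z
  rw [if_pos rfl] at this
  rw [← this, parityPoly, eval_finsetSum, Finset.sum_filter,
    ← (Equiv.arrowCongr e (Equiv.refl K)).symm.sum_comp]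
  refine Finset.sum_congr rfl fun x _ => ?_
  have hx : (Equiv.arrowCongr e (Equiv.refl K)).symm x = x ∘ e := rfl
  have h1 : ∑ i, h i * (x ∘ e) i = ∑ i, h (e.symm i) * x i := by
    rw [← e.sum_comp]
    simp
  rw [hx, h1, hammingNorm_comp_equiv]
  simp

open Polynomial in
lemma isWeightPoly_parityPoly {K : Type} [Field K] [Fintype K] [DecidableEq K] {σ : Type}
    [Fintype σ] [DecidableEq σ] (h : σ → K) (n : ℕ) (hn : Fintype.card σ ≤ n) :
    IsWeightPoly (parityPoly h) n ((Fintype.card K : ℝ) ^ n) where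
  coeff_nonneg j := by
    rw [parityPoly, finsetSum_coeff]
    refine Finset.sum_nonneg fun x _ => ?_
    rw [coeff_X_pow]
    split_ifs <;> norm_num
  coeff_zero := by
    rw [parityPoly, finsetSum_coeff, Finset.sum_eq_single (0 : σ → K)]
    · simp
    · intro x _ hx
      rw [coeff_X_pow, if_neg]
      exact fun h0 => hx (hammingNorm_eq_zero.1 h0.symm)
    · simp
  natDegree_le := by
    refine natDegree_sum_le_of_forall_le _ _ fun x _ => ?_
    rw [natDegree_X_pow]
    exact hammingNorm_le_card_fintype.trans hn
  eval_one_le := by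
    have hq : (1:ℝ) ≤ Fintype.card K := by exact_mod_cast Fintype.card_pos
    rw [parityPoly, eval_finsetSum]
    simp only [eval_pow, eval_X, one_pow, Finset.sum_const, nsmul_eq_mul, mul_one]
    calc ((Finset.univ.filter fun x : σ → K => ∑ i, h i * x i = 0).card : ℝ)
        ≤ Fintype.card (σ → K) := by exact_mod_cast Finset.card_le_univ _
      _ = (Fintype.card K : ℝ) ^ Fintype.card σ := by rw [Fintype.card_fun]; push_cast; rfl
      _ ≤ (Fintype.card K : ℝ) ^ n := pow_le_pow_right₀ hq hn

/-- Value at `z` of the weight enumerator of a single parity check code of length `s`. -/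
def parityEnum (q s : ℕ) (z : ℝ) : ℝ :=
  ((1 + ((q:ℝ) - 1) * z) ^ s + ((q:ℝ) - 1) * (1 - z) ^ s) / q

lemma one_le_parityEnum {q s : ℕ} (hq : 2 ≤ q) {z : ℝ} (hz : 0 ≤ z) (hz1 : z ≤ 1) :
    1 ≤ parityEnum q s z := by
  have hq' : (2:ℝ) ≤ q := by exact_mod_cast hq
  have h1 := one_add_mul_le_pow (a := ((q:ℝ) - 1) * z)
    (by nlinarith [mul_nonneg (show (0:ℝ) ≤ (q:ℝ) - 1 by linarith) hz]) s
  have h2 := one_add_mul_le_pow (a := -z) (by linarith) s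
  rw [← sub_eq_add_neg] at h2
  rw [parityEnum, le_div_iff₀ (by linarith)]
  have h3 := mul_le_mul_of_nonneg_left h2 (show (0:ℝ) ≤ (q:ℝ) - 1 by linarith)
  nlinarith

lemma lambdaQ_term_eq {q s : ℕ} (hq : 2 ≤ q) (ω : ℝ) {z : ℝ} (hz : 0 ≤ z)
    (hz1 : z ≤ 1) :
    -ω * Real.logb q z - 1 / s +
      (1 / s) * Real.logb q ((1 + ((q:ℝ) - 1) * z) ^ s + ((q:ℝ) - 1) * (1 - z) ^ s) =
    -ω * Real.logb q z + (1 / s) * Real.logb q (parityEnum q s z) := by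
  have hq' : (2:ℝ) ≤ q := by exact_mod_cast hq
  have h1 := one_le_parityEnum (s := s) hq hz hz1
  have heq : (1 + ((q:ℝ) - 1) * z) ^ s + ((q:ℝ) - 1) * (1 - z) ^ s =
      q * parityEnum q s z := by
    rw [parityEnum]
    field_simp
  rw [heq, Real.logb_mul (by positivity) (by positivity),
    Real.logb_self_eq_one (by linarith)]
  ring

lemma lambdaQ_term_nonneg {q s : ℕ} (hq : 2 ≤ q) {ω : ℝ} (hω : 0 ≤ ω) {z : ℝ}
    (hz : 0 ≤ z) (hz1 : z ≤ 1) :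
    0 ≤ -ω * Real.logb q z + (1 / s) * Real.logb q (parityEnum q s z) := by
  have hq' : (1:ℝ) < q := by exact_mod_cast hq
  have h1 := Real.logb_nonneg hq' (one_le_parityEnum (s := s) hq hz hz1)
  have h2 := Real.logb_nonpos hq' hz hz1
  have h3 : 0 ≤ ω * -Real.logb q z := mul_nonneg hω (by linarith)
  have h4 : 0 ≤ (1 / (s:ℝ)) * Real.logb q (parityEnum q s z) := mul_nonneg (by positivity) h1
  linarith

lemma lambdaQ_le {q s : ℕ} (hq : 2 ≤ q) {ω : ℝ} (hω : 0 ≤ ω) {z : ℝ}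
    (hz : 0 < z) (hz1 : z ≤ 1) :
    lambdaQ q ω s ≤ -ω * Real.logb q z + (1 / s) * Real.logb q (parityEnum q s z) := by
  rw [← lambdaQ_term_eq hq ω hz.le hz1]
  refine ciInf_le (f := fun z : Set.Ioc (0:ℝ) 1 => -ω * Real.logb q (z : ℝ) - 1 / s +
      (1 / s) * Real.logb q ((1 + ((q:ℝ) - 1) * (z:ℝ)) ^ s + ((q:ℝ) - 1) * (1 - (z:ℝ)) ^ s))
    ⟨0, ?_⟩ ⟨z, hz, hz1⟩
  rintro _ ⟨w, rfl⟩
  dsimp only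
  rw [lambdaQ_term_eq hq ω w.2.1.le w.2.2]
  exact lambdaQ_term_nonneg hq hω w.2.1.le w.2.2

lemma lambdaQ_nonneg {q s : ℕ} (hq : 2 ≤ q) {ω : ℝ} (hω : 0 ≤ ω) :
    0 ≤ lambdaQ q ω s := by
  have : Nonempty (Set.Ioc (0:ℝ) 1) := ⟨⟨1, one_pos, le_rfl⟩⟩
  refine le_ciInf fun w => ?_
  rw [lambdaQ_term_eq hq ω w.2.1.le w.2.2]
  exact lambdaQ_term_nonneg hq hω w.2.1.le w.2.2

lemma R0_le_one {q s : ℕ} (hq : 2 ≤ q) (hs : 1 ≤ s) {ω : ℝ} (hω : 0 ≤ ω) :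
    R0 q ω s ≤ 1 := by
  have h1 := lambdaQ_nonneg (s := s) hq hω
  have hs' : (0:ℝ) < s := by exact_mod_cast hs
  have h2 : ((s:ℝ) - 1) / s ≤ 1 := by
    rw [div_le_one hs']
    linarith
  rw [R0]
  linarith

lemma R0_nonneg {q s : ℕ} (hq : 2 ≤ q) (hs : 1 ≤ s) {ω : ℝ} (hω : 0 ≤ ω) :
    0 ≤ R0 q ω s := by
  have hq' : (1:ℝ) < q := by exact_mod_cast hq
  have hs' : (0:ℝ) < s := by exact_mod_cast hs
  have h := lambdaQ_le (s := s) hq hω one_pos le_rfl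
  rw [← lambdaQ_term_eq hq ω zero_le_one le_rfl] at h
  have hlog : Real.logb q ((1 + ((q:ℝ) - 1) * 1) ^ s + ((q:ℝ) - 1) * (1 - 1) ^ s) = s := by
    rw [sub_self, zero_pow (by omega), mul_zero, add_zero, mul_one, add_sub_cancel,
      Real.logb_pow, Real.logb_self_eq_one hq', mul_one]
  rw [hlog, Real.logb_one, one_div_mul_cancel hs'.ne'] at h
  have : ((s:ℝ) - 1) / s = 1 - 1 / s := by field_simp
  rw [R0, this]
  linarith

lemma innerMin_nonneg {q : ℕ} (hq : 2 ≤ q) (n : ℕ) (ω : ℝ) {π : ℕ → ℝ}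
    (hπ : ∀ s ∈ Finset.Icc 1 n, 0 ≤ π s) : 0 ≤ innerMin q n ω π := by
  refine Real.sInf_nonneg ?_
  rintro t ⟨ϑ, hϑ, -, rfl⟩
  exact Finset.sum_nonneg fun s hs =>
    mul_nonneg (hπ s hs) (R0_nonneg hq (Finset.mem_Icc.1 hs).1 (hϑ s hs))

lemma innerMin_le_one {q : ℕ} (hq : 2 ≤ q) (n : ℕ) {ω : ℝ} (hω : 0 ≤ ω) {π : ℕ → ℝ}
    (hπ : ∀ s ∈ Finset.Icc 1 n, 0 ≤ π s) (hπ1 : ∑ s ∈ Finset.Icc 1 n, π s = 1) :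
    innerMin q n ω π ≤ 1 := by
  have hbdd : BddBelow {t : ℝ | ∃ ϑ : ℕ → ℝ, (∀ s ∈ Finset.Icc 1 n, 0 ≤ ϑ s) ∧
      (∑ s ∈ Finset.Icc 1 n, π s * ϑ s) = ω ∧
      t = ∑ s ∈ Finset.Icc 1 n, π s * R0 q (ϑ s) s} := by
    refine ⟨0, ?_⟩
    rintro t ⟨ϑ, hϑ, -, rfl⟩
    exact Finset.sum_nonneg fun s hs =>
      mul_nonneg (hπ s hs) (R0_nonneg hq (Finset.mem_Icc.1 hs).1 (hϑ s hs))
  refine (csInf_le hbdd ⟨fun _ => ω, fun _ _ => hω, ?_, rfl⟩).trans ?_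
  · rw [← Finset.sum_mul, hπ1, one_mul]
  · rw [← hπ1]
    refine Finset.sum_le_sum fun s hs => ?_
    exact mul_le_of_le_one_right (hπ s hs) (R0_le_one hq (Finset.mem_Icc.1 hs).1 hω)

lemma Rbar0_nonneg {q : ℕ} (hq : 2 ≤ q) (n : ℕ) (ω μ : ℝ) : 0 ≤ Rbar0 q n ω μ := by
  refine Real.sSup_nonneg ?_
  rintro r ⟨π, hπ, -, -, rfl⟩
  exact innerMin_nonneg hq n ω hπ

lemma Rbar0_le_one {q : ℕ} (hq : 2 ≤ q) (n : ℕ) {ω : ℝ} (hω : 0 ≤ ω) (μ : ℝ) :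
    Rbar0 q n ω μ ≤ 1 := by
  refine Real.sSup_le ?_ zero_le_one
  rintro r ⟨π, hπ, hπ1, -, rfl⟩
  exact innerMin_le_one hq n hω hπ hπ1

lemma innerMin_le_Rbar0 {q : ℕ} (hq : 2 ≤ q) (n : ℕ) {ω : ℝ} (hω : 0 ≤ ω) (μ : ℝ) {π : ℕ → ℝ}
    (hπ : ∀ s ∈ Finset.Icc 1 n, 0 ≤ π s) (hπ1 : ∑ s ∈ Finset.Icc 1 n, π s = 1)
    (hμ : 1 / μ ≤ ∑ s ∈ Finset.Icc 1 n, π s / (s : ℝ)) :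
    innerMin q n ω π ≤ Rbar0 q n ω μ := by
  refine le_csSup ⟨1, ?_⟩ ⟨π, hπ, hπ1, hμ, rfl⟩
  rintro r ⟨π', hπ', hπ1', -, rfl⟩
  exact innerMin_le_one hq n hω hπ' hπ1'

lemma one_sub_pos_of_mem {n : ℕ} {ν : ℝ}
    (hν : ν ∈ Set.Icc (0:ℝ) (((n:ℝ) - 1) / ((n:ℝ) + 1))) : 0 < 1 - ν := by
  have : ((n:ℝ) - 1) / ((n:ℝ) + 1) < 1 := by
    rw [div_lt_one (by positivity)]
    linarith
  linarith [hν.2]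

lemma Rhat0_nonneg {q : ℕ} (hq : 2 ≤ q) (n : ℕ) (ω : ℝ) : 0 ≤ Rhat0 q n ω := by
  refine Real.sSup_nonneg ?_
  rintro r ⟨ν, hν, rfl⟩
  exact add_nonneg hν.1 (mul_nonneg (one_sub_pos_of_mem hν).le (Rbar0_nonneg hq n _ _))

lemma le_Rhat0 {q : ℕ} (hq : 2 ≤ q) (n : ℕ) {ω : ℝ} (hω : 0 ≤ ω) {ν : ℝ}
    (hν : ν ∈ Set.Icc (0:ℝ) (((n:ℝ) - 1) / ((n:ℝ) + 1))) :
    ν + (1 - ν) * Rbar0 q n (ω / (1 - ν)) (((1 - ν) / (1 + ν)) * n) ≤ Rhat0 q n ω := by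
  refine le_csSup ⟨1, ?_⟩ ⟨ν, hν, rfl⟩
  rintro r ⟨ν', hν', rfl⟩
  have h1 := one_sub_pos_of_mem hν'
  have h2 := Rbar0_le_one hq n (div_nonneg hω h1.le) (((1 - ν') / (1 + ν')) * n)
  nlinarith

lemma le_innerMin {q : ℕ} (hq : 2 ≤ q) (n : ℕ) {ω : ℝ} (hω : 0 ≤ ω) {π : ℕ → ℝ}
    (hπ : ∀ s ∈ Finset.Icc 1 n, 0 ≤ π s) (hπ1 : ∑ s ∈ Finset.Icc 1 n, π s = 1)
    {z : ℝ} (hz : 0 < z) (hz1 : z ≤ 1) :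
    ω * Real.logb q z + ∑ s ∈ Finset.Icc 1 n,
      π s * (1 - 1 / s - (1 / s) * Real.logb q (parityEnum q s z)) ≤ innerMin q n ω π := by
  refine le_csInf ⟨_, fun _ => ω, fun _ _ => hω, by rw [← Finset.sum_mul, hπ1, one_mul], rfl⟩ ?_
  rintro t ⟨ϑ, hϑ, hsum, rfl⟩
  rw [← hsum, Finset.sum_mul, ← Finset.sum_add_distrib]
  refine Finset.sum_le_sum fun s hs => ?_
  have hs1 := (Finset.mem_Icc.1 hs).1
  have hs' : (0:ℝ) < s := by exact_mod_cast hs1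
  have h1 := lambdaQ_le (s := s) hq (hϑ s hs) hz hz1
  have h2 : ((s:ℝ) - 1) / s = 1 - 1 / s := by field_simp
  rw [mul_assoc, ← mul_add]
  refine mul_le_mul_of_nonneg_left ?_ (hπ s hs)
  rw [R0, h2]
  linarith

/-- Packing estimate for a family `G` of disjoint parity checks of sizes `s g`, after
removing `t` of the `k` coordinates. -/
lemma packing_le_Rhat0 {q : ℕ} (hq : 2 ≤ q) {n : ℕ} {ω : ℝ} (hω : 0 ≤ ω)
    {ι : Type*} (G : Finset ι) (s : ι → ℕ) (k t : ℕ) (hs1 : ∀ g ∈ G, 1 ≤ s g)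
    (hsn : ∀ g ∈ G, s g ≤ n) (hsum : ∑ g ∈ G, s g + t = k) (hk : 0 < k)
    (hcover : k + t ≤ n * G.card) {z : ℝ} (hz : 0 < z) (hz1 : z ≤ 1) :
    (k:ℝ) - G.card - ∑ g ∈ G, Real.logb q (parityEnum q (s g) z) + ω * k * Real.logb q z ≤
      k * Rhat0 q n ω := by
  classical
  set N' := ∑ g ∈ G, s g with hN'
  have hGN : G.card ≤ N' := by
    rw [Finset.card_eq_sum_ones]
    exact Finset.sum_le_sum hs1
  have hGpos : 0 < G.card := by
    rcases Nat.eq_zero_or_pos G.card with h0 | h0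
    · rw [h0] at hcover
      omega
    · exact h0
  have hN'pos : 0 < N' := lt_of_lt_of_le hGpos hGN
  have hN'r : (0:ℝ) < N' := by exact_mod_cast hN'pos
  have hkr : (0:ℝ) < k := by exact_mod_cast hk
  have hsumr : (N':ℝ) + t = k := by exact_mod_cast hsum
  have hcoverr : (k:ℝ) + t ≤ n * G.card := by exact_mod_cast hcover
  have hGNr : (G.card : ℝ) ≤ N' := by exact_mod_cast hGN
  have ht0 : (0:ℝ) ≤ t := Nat.cast_nonneg t
  have hn0 : (0:ℝ) ≤ n := Nat.cast_nonneg n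
  have hnpos : (0:ℝ) < n := by
    rcases hn0.eq_or_lt with h | h
    · rw [← h, zero_mul] at hcoverr
      linarith
    · exact h
  set ν : ℝ := t / k with hνdef
  have h1ν : 1 - ν = N' / k := by
    rw [hνdef]
    field_simp
    linarith
  have hν : ν ∈ Set.Icc (0:ℝ) (((n:ℝ) - 1) / ((n:ℝ) + 1)) := by
    refine ⟨by positivity, ?_⟩
    rw [hνdef, div_le_div_iff₀ hkr (by positivity)]
    have := mul_le_mul_of_nonneg_left hGNr hn0
    nlinarith
  set π : ℕ → ℝ := fun r => r * ((G.filter fun g => s g = r).card : ℝ) / N' with hπdef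
  have hπF : ∀ F : ℕ → ℝ, ∑ r ∈ Finset.Icc 1 n, π r * F r =
      (∑ g ∈ G, s g * F (s g)) / N' := by
    intro F
    rw [← Finset.sum_fiberwise_of_maps_to (s := G) (t := Finset.Icc 1 n) (g := s)
      (fun g hg => Finset.mem_Icc.2 ⟨hs1 g hg, hsn g hg⟩), Finset.sum_div]
    refine Finset.sum_congr rfl fun r _ => ?_
    rw [Finset.sum_congr rfl (g := fun _ => (r:ℝ) * F r) fun g hg => by
      rw [(Finset.mem_filter.1 hg).2], Finset.sum_const, nsmul_eq_mul, hπdef]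
    ring
  have hπ0 : ∀ r ∈ Finset.Icc 1 n, 0 ≤ π r := fun r _ => by positivity
  have hπ1 : ∑ r ∈ Finset.Icc 1 n, π r = 1 := by
    have := hπF fun _ => 1
    simp only [mul_one] at this
    rw [this, hN', Nat.cast_sum, div_self]
    rw [← Nat.cast_sum]
    exact hN'r.ne'
  have hπinv : ∑ r ∈ Finset.Icc 1 n, π r / (r : ℝ) = G.card / N' := by
    simp only [div_eq_mul_inv (π _)]
    rw [hπF fun r => (r:ℝ)⁻¹, Finset.sum_congr rfl (g := fun _ => (1:ℝ)) fun g hg =>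
      mul_inv_cancel₀ (by exact_mod_cast (Nat.one_le_iff_ne_zero.1 (hs1 g hg)))]
    simp
  have hμ : 1 / (((1 - ν) / (1 + ν)) * n) ≤ ∑ r ∈ Finset.Icc 1 n, π r / (r : ℝ) := by
    have h1ν' : 1 + ν = (k + t) / k := by
      rw [hνdef]
      field_simp
    rw [hπinv, h1ν, h1ν']
    have : (1:ℝ) / ((N' / k) / ((k + t) / k) * n) = ((k + t) / n) / N' := by
      field_simp
    rw [this]
    refine div_le_div_of_nonneg_right ?_ hN'r.le
    rw [div_le_iff₀ hnpos]
    linarith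
  have hω' : 0 ≤ ω / (1 - ν) := div_nonneg hω (one_sub_pos_of_mem hν).le
  have h1 := le_innerMin hq n hω' hπ0 hπ1 hz hz1
  have h2 := innerMin_le_Rbar0 hq n hω' (((1 - ν) / (1 + ν)) * n) hπ0 hπ1 hμ
  have h3 := le_Rhat0 hq n hω hν
  rw [hπF fun s => 1 - 1 / (s:ℝ) - (1 / (s:ℝ)) * Real.logb q (parityEnum q s z)] at h1
  have h4 : ∑ g ∈ G, (s g : ℝ) * (1 - 1 / (s g : ℝ) -
      (1 / (s g : ℝ)) * Real.logb q (parityEnum q (s g) z)) =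
      N' - G.card - ∑ g ∈ G, Real.logb q (parityEnum q (s g) z) := by
    rw [Finset.sum_congr rfl (g := fun g => (s g : ℝ) - 1 -
      Real.logb q (parityEnum q (s g) z)) fun g hg => by
        have : (s g : ℝ) ≠ 0 := by exact_mod_cast (Nat.one_le_iff_ne_zero.1 (hs1 g hg))
        field_simp, Finset.sum_sub_distrib, Finset.sum_sub_distrib, hN']
    simp
  rw [h4] at h1
  have h5 : ν + (1 - ν) * (ω / (1 - ν) * Real.logb q z +
      (N' - G.card - ∑ g ∈ G, Real.logb q (parityEnum q (s g) z)) / N') ≤ Rhat0 q n ω :=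
    le_trans (add_le_add le_rfl (mul_le_mul_of_nonneg_left (h1.trans h2)
      (one_sub_pos_of_mem hν).le)) h3
  have h6 := mul_le_mul_of_nonneg_left h5 hkr.le
  refine le_trans (le_of_eq ?_) h6
  rw [h1ν, hνdef, ← hsumr]
  have : (N':ℝ) + t ≠ 0 := by rw [hsumr]; exact hkr.ne'
  field_simp
  ring

/-- A finite family of sets covering a finite type contains a subfamily that still covers it
and in which every member has a private point. -/
lemma exists_irredundant_cover {ι : Type} [Fintype ι] [DecidableEq ι] (A : ι → Finset ι)
    (hA : ∀ j, j ∈ A j) :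
    ∃ G : Finset ι, G.biUnion A = Finset.univ ∧
      ∀ g ∈ G, ∃ p ∈ A g, ∀ g' ∈ G, g' ≠ g → p ∉ A g' := by
  classical
  obtain ⟨G, hG, hmin⟩ := Finset.exists_min_image
    (Finset.univ.filter fun G : Finset ι => G.biUnion A = Finset.univ) Finset.card
    ⟨Finset.univ, Finset.mem_filter.2 ⟨Finset.mem_univ _, Finset.eq_univ_iff_forall.2 fun j =>
      Finset.mem_biUnion.2 ⟨j, Finset.mem_univ _, hA j⟩⟩⟩
  have hGc := (Finset.mem_filter.1 hG).2
  refine ⟨G, hGc, fun g hg => ?_⟩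
  by_contra hcon
  push Not at hcon
  have hcov : (G.erase g).biUnion A = Finset.univ := by
    refine Finset.eq_univ_iff_forall.2 fun i => ?_
    have hi : i ∈ G.biUnion A := by rw [hGc]; exact Finset.mem_univ i
    obtain ⟨g₁, hg₁, hig₁⟩ := Finset.mem_biUnion.1 hi
    by_cases h : g₁ = g
    · subst h
      obtain ⟨g₂, hg₂, hne, hi₂⟩ := hcon i hig₁
      exact Finset.mem_biUnion.2 ⟨g₂, Finset.mem_erase.2 ⟨hne, hg₂⟩, hi₂⟩
    · exact Finset.mem_biUnion.2 ⟨g₁, Finset.mem_erase.2 ⟨h, hg₁⟩, hig₁⟩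
  have := hmin _ (Finset.mem_filter.2 ⟨Finset.mem_univ _, hcov⟩)
  exact absurd (Finset.card_erase_lt_of_mem hg) (not_lt.2 this)

/-- A subfamily whose union has a size close to a prescribed value. -/
lemma exists_subfamily_card {ι : Type} [Fintype ι] [DecidableEq ι] (A : ι → Finset ι)
    (G : Finset ι) (hG : G.biUnion A = Finset.univ) (n : ℕ) (hn : ∀ g ∈ G, (A g).card ≤ n)
    (x : ℝ) (hx0 : 0 ≤ x) (hx : x < Fintype.card ι) :
    ∃ G' ⊆ G, ((G'.biUnion A).card : ℝ) ≤ x ∧ x < (G'.biUnion A).card + n := by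
  classical
  obtain ⟨G', hG', hmax⟩ := Finset.exists_max_image
    (G.powerset.filter fun G' : Finset ι => ((G'.biUnion A).card : ℝ) ≤ x) Finset.card
    ⟨∅, Finset.mem_filter.2 ⟨Finset.empty_mem_powerset _, by simpa using hx0⟩⟩
  have hsub := Finset.mem_powerset.1 (Finset.mem_filter.1 hG').1
  have hle := (Finset.mem_filter.1 hG').2
  refine ⟨G', hsub, hle, ?_⟩
  obtain ⟨g, hg, hgG'⟩ : ∃ g ∈ G, g ∉ G' := by
    by_contra hcon
    push Not at hcon
    have : G' = G := Finset.Subset.antisymm hsub hcon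
    rw [this, hG, Finset.card_univ] at hle
    linarith
  by_contra hcon
  have hcard : ((insert g G').biUnion A).card ≤ (G'.biUnion A).card + n := by
    rw [Finset.biUnion_insert]
    refine (Finset.card_union_le _ _).trans ?_
    have := hn g hg
    omega
  have hcard' : (((insert g G').biUnion A).card : ℝ) ≤ (G'.biUnion A).card + n := by
    exact_mod_cast hcard
  have := hmax (insert g G') (Finset.mem_filter.2 ⟨Finset.mem_powerset.2
    (Finset.insert_subset hg hsub), by linarith⟩)
  rw [Finset.card_insert_of_notMem hgG'] at this
  omega

section ParityChecks

set_option linter.unusedSectionVars false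

variable {K : Type} [Field K] [DecidableEq K] {ι γ : Type} [Fintype ι] [DecidableEq ι]
  [Fintype γ] [DecidableEq γ]

/-- Coordinates involved in at least one of the parity checks `h g`. -/
def coveredCoords (h : γ → ι → K) : Finset ι := Finset.univ.filter fun i => ∃ g, h g i ≠ 0

/-- Coordinates involved in at least two of the parity checks `h g`. -/
def overlapCoords (h : γ → ι → K) : Finset ι :=
  Finset.univ.filter fun i => ∃ g g', g ≠ g' ∧ h g i ≠ 0 ∧ h g' i ≠ 0

/-- Coordinates involved in the parity check `h g` and in no other one. -/
def ownCoords (h : γ → ι → K) (g : γ) : Finset ι :=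
  Finset.univ.filter fun i => h g i ≠ 0 ∧ ∀ g', g' ≠ g → h g' i = 0

lemma sum_card_ownCoords (h : γ → ι → K) :
    ∑ g, (ownCoords h g).card + (overlapCoords h).card = (coveredCoords h).card := by
  have hdisj : (↑(Finset.univ : Finset γ) : Set γ).PairwiseDisjoint (ownCoords h) := by
    intro g _ g' _ hne
    refine Finset.disjoint_left.2 fun i hi hi' => ?_
    exact (Finset.mem_filter.1 hi).2.1 ((Finset.mem_filter.1 hi').2.2 g hne)
  rw [← Finset.card_biUnion hdisj, ← Finset.card_union_of_disjoint]
  · congr 1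
    ext i
    simp only [Finset.mem_union, Finset.mem_biUnion, Finset.mem_univ, true_and, ownCoords,
      overlapCoords, coveredCoords, Finset.mem_filter]
    constructor
    · rintro (⟨g, hg, -⟩ | ⟨g, g', -, hg, -⟩) <;> exact ⟨g, hg⟩
    · rintro ⟨g, hg⟩
      by_cases hall : ∀ g', g' ≠ g → h g' i = 0
      · exact Or.inl ⟨g, hg, hall⟩
      · push Not at hall
        obtain ⟨g', hne, hg'⟩ := hall
        exact Or.inr ⟨g', g, hne, hg', hg⟩
  · refine Finset.disjoint_left.2 fun i hi hi' => ?_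
    obtain ⟨g, -, hg⟩ := Finset.mem_biUnion.1 hi
    obtain ⟨g₁, g₂, hne, h₁, h₂⟩ := (Finset.mem_filter.1 hi').2
    have hown := (Finset.mem_filter.1 hg).2.2
    by_cases hg₁ : g₁ = g
    · exact h₂ (hown g₂ fun e => hne (hg₁.trans e.symm))
    · exact h₁ (hown g₁ hg₁)

lemma card_covered_add_card_overlap_le (h : γ → ι → K) (n : ℕ)
    (hn : ∀ g, (Finset.univ.filter fun i => h g i ≠ 0).card ≤ n) :
    (coveredCoords h).card + (overlapCoords h).card ≤ n * Fintype.card γ := by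
  have h1 : ∑ g, (Finset.univ.filter fun i => h g i ≠ 0).card ≤ n * Fintype.card γ := by
    refine (Finset.sum_le_sum fun g _ => hn g).trans ?_
    rw [Finset.sum_const, smul_eq_mul, Finset.card_univ, mul_comm]
  refine le_trans ?_ h1
  simp only [Finset.card_filter, coveredCoords, overlapCoords]
  rw [Finset.sum_comm, ← Finset.sum_add_distrib]
  refine Finset.sum_le_sum fun i _ => ?_
  rw [← Finset.card_filter]
  by_cases h2 : ∃ g g', g ≠ g' ∧ h g i ≠ 0 ∧ h g' i ≠ 0
  · have : 1 < (Finset.univ.filter fun g => h g i ≠ 0).card := by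
      obtain ⟨g, g', hne, hg, hg'⟩ := h2
      exact Finset.one_lt_card.2 ⟨g, by simpa using hg, g', by simpa using hg', hne⟩
    split_ifs <;> omega
  · by_cases h3 : ∃ g, h g i ≠ 0
    · have : 0 < (Finset.univ.filter fun g => h g i ≠ 0).card := by
        obtain ⟨g, hg⟩ := h3
        exact Finset.card_pos.2 ⟨g, by simpa using hg⟩
      rw [if_pos h3, if_neg h2]
      omega
    · rw [if_neg h3, if_neg h2]
      omega

variable [Fintype K]

/-- Words supported on the covered coordinates that satisfy all the parity checks. -/
def checkCode (h : γ → ι → K) : Finset (ι → K) :=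
  Finset.univ.filter fun v => (∀ i, i ∉ coveredCoords h → v i = 0) ∧ ∀ g, ∑ i, h g i * v i = 0

lemma mem_checkCode {h : γ → ι → K} {v : ι → K} : v ∈ checkCode h ↔
    (∀ i, i ∉ coveredCoords h → v i = 0) ∧ ∀ g, ∑ i, h g i * v i = 0 := by
  simp [checkCode]

lemma sub_mem_checkCode {h : γ → ι → K} {u v : ι → K} (hu : u ∈ checkCode h)
    (hv : v ∈ checkCode h) : u - v ∈ checkCode h := by
  rw [mem_checkCode] at *
  refine ⟨fun i hi => by simp [hu.1 i hi, hv.1 i hi], fun g => ?_⟩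
  simp only [Pi.sub_apply, mul_sub, Finset.sum_sub_distrib, hu.2 g, hv.2 g, sub_zero]

lemma card_checkCode_le (h : γ → ι → K) (p : γ → ι) (hp : ∀ g, p g ∈ ownCoords h g) :
    (checkCode h).card ≤ Fintype.card K ^ ((coveredCoords h).card - Fintype.card γ) := by
  have hp1 : ∀ g, h g (p g) ≠ 0 := fun g => (Finset.mem_filter.1 (hp g)).2.1
  have hp2 : ∀ g g', g' ≠ g → h g' (p g) = 0 := fun g => (Finset.mem_filter.1 (hp g)).2.2
  have hinj : Function.Injective p := fun g g' hgg' => by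
    by_contra hne
    exact hp1 g' (hgg' ▸ hp2 g g' (Ne.symm hne))
  have hsub : Finset.univ.image p ⊆ coveredCoords h := fun i hi => by
    obtain ⟨g, -, rfl⟩ := Finset.mem_image.1 hi
    exact Finset.mem_filter.2 ⟨Finset.mem_univ _, g, hp1 g⟩
  set R := coveredCoords h \ Finset.univ.image p with hR
  have hRcard : R.card = (coveredCoords h).card - Fintype.card γ := by
    rw [hR, Finset.card_sdiff_of_subset hsub, Finset.card_image_of_injective _ hinj,
      Finset.card_univ]
  have hfun : Fintype.card K ^ R.card = (Finset.univ : Finset (R → K)).card := by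
    rw [Finset.card_univ, Fintype.card_fun, Fintype.card_coe]
  rw [← hRcard, hfun]
  refine Finset.card_le_card_of_injOn (fun v (i : R) => v i) (fun _ _ => Finset.mem_univ _) ?_
  intro u hu v hv huv
  have hw := mem_checkCode.1 (sub_mem_checkCode hu hv)
  have hoff : ∀ i, i ∉ Finset.univ.image p → (u - v) i = 0 := fun i hi => by
    by_cases hic : i ∈ coveredCoords h
    · have := congrFun huv ⟨i, Finset.mem_sdiff.2 ⟨hic, hi⟩⟩
      simpa [sub_eq_zero] using this
    · exact hw.1 i hic
  rw [← sub_eq_zero]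
  funext i
  by_cases hi : i ∈ Finset.univ.image p
  · obtain ⟨g, -, rfl⟩ := Finset.mem_image.1 hi
    have hg := hw.2 g
    rw [Finset.sum_eq_single (p g)] at hg
    · exact (mul_eq_zero.1 hg).resolve_left (hp1 g)
    · intro i _ hne
      by_cases hi' : i ∈ Finset.univ.image p
      · obtain ⟨g', -, rfl⟩ := Finset.mem_image.1 hi'
        rw [hp2 g' g fun e => hne (by rw [e]), zero_mul]
      · rw [hoff i hi', mul_zero]
    · simp
  · exact hoff i hi

/-- Concatenation of words on the sets of own coordinates, extended by zero. -/
def glueOwn (h : γ → ι → K) (x : ∀ g, ownCoords h g → K) : ι → K := fun i =>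
  ∑ g, if hi : i ∈ ownCoords h g then x g ⟨i, hi⟩ else 0

lemma ownCoords_unique {h : γ → ι → K} {g g' : γ} {i : ι} (hi : i ∈ ownCoords h g)
    (hi' : i ∈ ownCoords h g') : g' = g := by
  by_contra hne
  exact (Finset.mem_filter.1 hi').2.1 ((Finset.mem_filter.1 hi).2.2 g' hne)

lemma glueOwn_apply (h : γ → ι → K) (x : ∀ g, ownCoords h g → K) (g : γ)
    (i : ownCoords h g) : glueOwn h x i = x g i := by
  rw [glueOwn, Finset.sum_eq_single g]
  · rw [dif_pos i.2]
  · intro g' _ hne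
    rw [dif_neg fun hi' => hne (ownCoords_unique i.2 hi')]
  · simp

lemma glueOwn_injective (h : γ → ι → K) : Function.Injective (glueOwn h) := by
  intro x y hxy
  funext g i
  rw [← glueOwn_apply h x g i, ← glueOwn_apply h y g i, hxy]

lemma glueOwn_eq_zero (h : γ → ι → K) (x : ∀ g, ownCoords h g → K) {i : ι}
    (hi : ∀ g, i ∉ ownCoords h g) : glueOwn h x i = 0 :=
  Finset.sum_eq_zero fun g _ => dif_neg (hi g)

lemma hammingNorm_glueOwn_le (h : γ → ι → K) (x : ∀ g, ownCoords h g → K) :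
    hammingNorm (glueOwn h x) ≤ ∑ g, hammingNorm (x g) := by
  have hsub : (Finset.univ.filter fun i => glueOwn h x i ≠ 0) ⊆ Finset.univ.biUnion fun g =>
      (Finset.univ.filter fun i : ownCoords h g => x g i ≠ 0).map
        (Function.Embedding.subtype _) := by
    intro i hi
    have hne := (Finset.mem_filter.1 hi).2
    obtain ⟨g, hg⟩ : ∃ g, i ∈ ownCoords h g := by
      by_contra hcon
      push Not at hcon
      exact hne (glueOwn_eq_zero h x hcon)
    refine Finset.mem_biUnion.2 ⟨g, Finset.mem_univ _, Finset.mem_map.2 ⟨⟨i, hg⟩, ?_, rfl⟩⟩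
    rw [Finset.mem_filter, ← glueOwn_apply h x g ⟨i, hg⟩]
    exact ⟨Finset.mem_univ _, hne⟩
  refine (Finset.card_le_card hsub).trans (Finset.card_biUnion_le.trans ?_)
  simp only [Finset.card_map]
  exact le_rfl

lemma glueOwn_mem_checkCode (h : γ → ι → K) (x : ∀ g, ownCoords h g → K)
    (hx : ∀ g, ∑ i : ownCoords h g, h g (i : ι) * x g i = 0) : glueOwn h x ∈ checkCode h := by
  rw [mem_checkCode]
  refine ⟨fun i hi => glueOwn_eq_zero h x fun g hg => hi ?_, fun g => ?_⟩
  · exact Finset.mem_filter.2 ⟨Finset.mem_univ _, g, (Finset.mem_filter.1 hg).2.1⟩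
  · rw [← hx g, ← Finset.sum_subset (Finset.subset_univ (ownCoords h g)),
      ← Finset.sum_coe_sort (ownCoords h g)]
    · exact Finset.sum_congr rfl fun i _ => by rw [glueOwn_apply]
    · intro i _ hi
      by_cases hg : h g i = 0
      · rw [hg, zero_mul]
      · rw [glueOwn_eq_zero h x fun g' hg' => ?_, mul_zero]
        by_cases hgg : g = g'
        · exact hi (hgg ▸ hg')
        · exact hg ((Finset.mem_filter.1 hg').2.2 g hgg)

open Polynomial in
/-- The low-degree coefficients of the product of the weight enumerators of the shortened
parity checks count words of low weight. -/
lemma sum_coeff_le_card_ball (h : γ → ι → K) (r : ℕ) :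
    ∑ j ∈ Finset.range (r + 1),
      (∏ g, parityPoly fun i : ownCoords h g => h g (i : ι)).coeff j ≤
      (((checkCode h).filter fun v => hammingNorm v ≤ r).card : ℝ) := by
  simp only [parityPoly]
  rw [Finset.prod_univ_sum]
  simp only [Finset.prod_pow_eq_pow_sum, finsetSum_coeff, coeff_X_pow]
  rw [Finset.sum_comm]
  simp only [Finset.sum_ite_eq', Finset.mem_range, Nat.lt_succ_iff]
  rw [← Finset.sum_filter, Finset.sum_const, nsmul_eq_mul, mul_one, Nat.cast_le]
  refine Finset.card_le_card_of_injOn (glueOwn h) (fun x hx => ?_)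
    ((glueOwn_injective h).injOn)
  have hx' := Finset.mem_filter.1 hx
  refine Finset.mem_filter.2 ⟨glueOwn_mem_checkCode h x fun g => ?_,
    (hammingNorm_glueOwn_le h x).trans hx'.2⟩
  exact (Finset.mem_filter.1 (Fintype.mem_piFinset.1 hx'.1 g)).2

end ParityChecks

/-- Averaging over the translates of a set of small words in a group. -/
lemma exists_dense_translate {A κ : Type*} [AddCommGroup A] (V : Finset A)
    (hV : V.Nonempty) (hsub : ∀ u ∈ V, ∀ v ∈ V, u - v ∈ V) (P : A → Prop) [DecidablePred P]
    (C : Finset κ) (f : κ → A) (hf : ∀ c ∈ C, f c ∈ V) :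
    ∃ v ∈ V, C.card * (V.filter P).card ≤ V.card * (C.filter fun c => P (f c - v)).card := by
  refine Finset.exists_le_of_sum_le hV ?_
  have hcount : ∀ c ∈ C, (V.filter fun v => P (f c - v)).card = (V.filter P).card := by
    intro c hc
    refine Finset.card_nbij' (fun v => f c - v) (fun v => f c - v) ?_ ?_ ?_ ?_
    · intro v hv
      have hv' := Finset.mem_filter.1 hv
      exact Finset.mem_filter.2 ⟨hsub _ (hf c hc) _ hv'.1, hv'.2⟩
    · intro v hv
      have hv' := Finset.mem_filter.1 hv
      exact Finset.mem_filter.2 ⟨hsub _ (hf c hc) _ hv'.1, by simpa using hv'.2⟩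
    · intro v _
      simp
    · intro v _
      simp
  rw [Finset.sum_const, smul_eq_mul, ← Finset.mul_sum]
  refine Nat.mul_le_mul_left _ (le_of_eq ?_)
  simp only [Finset.card_filter]
  rw [Finset.sum_comm]
  simp only [← Finset.card_filter]
  rw [Finset.sum_congr rfl hcount, Finset.sum_const, smul_eq_mul]

section RateFunctions

set_option linter.unusedSectionVars false

variable {K : Type} [Field K] [Fintype K] [DecidableEq K]

lemma logb_ncard_nonneg {q N : ℕ} (hq : 2 ≤ q) (C : Set (Fin N → K)) :
    0 ≤ Real.logb q (C.ncard : ℝ) / N := by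
  have hq' : (1:ℝ) < q := by exact_mod_cast hq
  refine div_nonneg ?_ (Nat.cast_nonneg N)
  rcases Nat.eq_zero_or_pos C.ncard with h | h
  · simp [h]
  · exact Real.logb_nonneg hq' (by exact_mod_cast h)

lemma logb_ncard_le_one {q N : ℕ} (hq : 2 ≤ q) (hcard : Fintype.card K = q)
    (C : Set (Fin N → K)) : Real.logb q (C.ncard : ℝ) / N ≤ 1 := by
  have hq' : (1:ℝ) < q := by exact_mod_cast hq
  refine div_le_one_of_le₀ ?_ (Nat.cast_nonneg N)
  rcases Nat.eq_zero_or_pos C.ncard with h | h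
  · simp [h]
  · have hle : C.ncard ≤ q ^ N := by
      refine (Set.ncard_le_ncard (Set.subset_univ C)).trans ?_
      rw [Set.ncard_univ, Nat.card_eq_fintype_card, Fintype.card_fun, hcard, Fintype.card_fin]
    calc Real.logb q (C.ncard : ℝ) ≤ Real.logb q ((q:ℝ) ^ N) :=
          Real.logb_le_logb_of_le hq' (by exact_mod_cast h) (by exact_mod_cast hle)
      _ = N := by rw [Real.logb_pow, Real.logb_self_eq_one hq', mul_one]

lemma limsup_rate_le_one {q : ℕ} (hq : 2 ≤ q) (hcard : Fintype.card K = q) (N : ℕ → ℕ)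
    (C : ∀ i : ℕ, Set (Fin (N i) → K)) :
    limsup (fun i => Real.logb q ((C i).ncard : ℝ) / (N i : ℝ)) atTop ≤ 1 :=
  limsup_le_of_le
    (IsBoundedUnder.isCoboundedUnder_le ⟨0, eventually_map.2 (Eventually.of_forall fun i => by
      exact logb_ncard_nonneg hq (C i))⟩)
    (Eventually.of_forall fun i => logb_ncard_le_one hq hcard (C i))

lemma limsup_rate_nonneg {q : ℕ} (hq : 2 ≤ q) (hcard : Fintype.card K = q) (N : ℕ → ℕ)
    (C : ∀ i : ℕ, Set (Fin (N i) → K)) :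
    0 ≤ limsup (fun i => Real.logb q ((C i).ncard : ℝ) / (N i : ℝ)) atTop :=
  le_limsup_of_frequently_le
    (Eventually.of_forall fun i => logb_ncard_nonneg hq (C i)).frequently
    ⟨1, eventually_map.2 (Eventually.of_forall fun i => by
      exact logb_ncard_le_one hq hcard (C i))⟩

lemma Ropt_nonneg {q : ℕ} (hq : 2 ≤ q) (hcard : Fintype.card K = q) (δ : ℝ) :
    0 ≤ Ropt K q δ := by
  refine Real.sSup_nonneg ?_
  rintro R ⟨N, C, -, -, -, rfl⟩
  exact limsup_rate_nonneg hq hcard N C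

lemma minDist_le_hammingDist {ι : Type} [Fintype ι] {C : Set (ι → K)} {c c' : ι → K}
    (hc : c ∈ C) (hc' : c' ∈ C) (hne : c ≠ c') : minDist C ≤ hammingDist c c' :=
  Nat.sInf_le ⟨c, hc, c', hc', hne, rfl⟩

lemma exists_hammingDist_eq_minDist {ι : Type} [Fintype ι] {C : Set (ι → K)}
    (hC : ∃ c ∈ C, ∃ c' ∈ C, c ≠ c') :
    ∃ c ∈ C, ∃ c' ∈ C, c ≠ c' ∧ hammingDist c c' = minDist C := by
  obtain ⟨c, hc, c', hc', hne⟩ := hC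
  exact Nat.sInf_mem (s := {d : ℕ | ∃ c ∈ C, ∃ c' ∈ C, c ≠ c' ∧ hammingDist c c' = d})
    ⟨_, c, hc, c', hc', hne, rfl⟩

lemma minDist_div_le_one {N : ℕ} (C : Set (Fin N → K)) : (minDist C : ℝ) / N ≤ 1 := by
  refine div_le_one_of_le₀ ?_ (Nat.cast_nonneg N)
  by_cases hC : ∃ c ∈ C, ∃ c' ∈ C, c ≠ c'
  · obtain ⟨c, -, c', -, -, h⟩ := exists_hammingDist_eq_minDist hC
    rw [← h]
    exact_mod_cast hammingDist_le_card_fintype.trans (Fintype.card_fin N).le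
  · have : {d : ℕ | ∃ c ∈ C, ∃ c' ∈ C, c ≠ c' ∧ hammingDist c c' = d} = ∅ := by
      refine Set.eq_empty_iff_forall_notMem.2 ?_
      rintro d ⟨c, hc, c', hc', hne, -⟩
      exact hC ⟨c, hc, c', hc', hne⟩
    rw [minDist, this, Nat.sInf_empty]
    simp

/-- Uniform finite-length form of the definition of `Ropt`. -/
lemma exists_Ropt_uniform {q : ℕ} (hq : 2 ≤ q) (hcard : Fintype.card K = q) (θ η : ℝ)
    (hη : 0 < η) :
    ∃ ε > 0, ∃ M₀ : ℕ, ∀ M, M₀ ≤ M → ∀ D : Finset (Fin M → K),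
      (∀ c ∈ D, ∀ c' ∈ D, c ≠ c' → (θ - ε) * M ≤ hammingDist c c') →
      Real.logb q (D.card : ℝ) ≤ (Ropt K q θ + η) * M := by
  by_contra hcon
  push Not at hcon
  have hR0 := Ropt_nonneg (K := K) hq hcard θ
  have hfreq : ∀ j : ℕ, ∃ᶠ M in atTop, ∃ D : Finset (Fin M → K), 0 < M ∧
      (∀ c ∈ D, ∀ c' ∈ D, c ≠ c' → (θ - 1 / ((j:ℝ) + 1)) * M ≤ hammingDist c c') ∧
      (Ropt K q θ + η) * M < Real.logb q (D.card : ℝ) := by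
    intro j
    rw [frequently_atTop]
    intro a
    obtain ⟨M, hM, D, hD, hlt⟩ := hcon (1 / ((j:ℝ) + 1)) (by positivity) (max a 1)
    exact ⟨M, (le_max_left _ _).trans hM, D, (le_max_right a 1).trans hM, hD, hlt⟩
  obtain ⟨N, hN, hbad⟩ := extraction_forall_of_frequently hfreq
  choose D hNpos hDdist hDlog using hbad
  have hpair : ∀ j, ∃ c ∈ (D j : Set (Fin (N j) → K)), ∃ c' ∈ (D j : Set (Fin (N j) → K)),
      c ≠ c' := by
    intro j
    have hpos : 0 < Real.logb q ((D j).card : ℝ) :=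
      lt_of_le_of_lt (by positivity) (hDlog j)
    have hcard1 : 1 < (D j).card := by
      by_contra hle
      have : (D j).card = 0 ∨ (D j).card = 1 := by omega
      rcases this with h | h <;> simp [h] at hpos
    obtain ⟨c, hc, c', hc', hne⟩ := Finset.one_lt_card.1 hcard1
    exact ⟨c, hc, c', hc', hne⟩
  have hrate : ∀ j, Ropt K q θ + η ≤
      Real.logb q ((D j : Set (Fin (N j) → K)).ncard : ℝ) / (N j : ℝ) := by
    intro j
    rw [Set.ncard_coe_finset, le_div_iff₀ (by exact_mod_cast hNpos j)]
    exact (hDlog j).le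
  have hdist : ∀ j : ℕ, θ - 1 / ((j:ℝ) + 1) ≤
      (minDist (D j : Set (Fin (N j) → K)) : ℝ) / (N j : ℝ) := by
    intro j
    obtain ⟨c, hc, c', hc', hne, h⟩ := exists_hammingDist_eq_minDist (hpair j)
    rw [← h, le_div_iff₀ (by exact_mod_cast hNpos j)]
    exact hDdist j c hc c' hc' hne
  have hlim : θ ≤ liminf (fun j => (minDist (D j : Set (Fin (N j) → K)) : ℝ) / (N j : ℝ))
      atTop := by
    refine le_of_forall_pos_sub_le fun e he => ?_
    refine le_liminf_of_le (IsBoundedUnder.isCoboundedUnder_ge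
      ⟨1, eventually_map.2 (Eventually.of_forall fun j => by
        exact minDist_div_le_one (D j : Set (Fin (N j) → K)))⟩) ?_
    obtain ⟨j₀, hj₀⟩ := exists_nat_one_div_lt he
    filter_upwards [eventually_ge_atTop j₀] with j hj
    have h1 : 1 / ((j:ℝ) + 1) ≤ 1 / ((j₀:ℝ) + 1) := Nat.one_div_le_one_div hj
    have := hdist j
    linarith
  have hle : limsup (fun j => Real.logb q ((D j : Set (Fin (N j) → K)).ncard : ℝ) / (N j : ℝ))
      atTop ≤ Ropt K q θ := by
    refine le_csSup ⟨1, ?_⟩ ⟨N, fun j => (D j : Set (Fin (N j) → K)), hN, fun j => ?_, hlim, rfl⟩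
    · rintro R ⟨N, C, -, -, -, rfl⟩
      exact limsup_rate_le_one hq hcard N C
    · obtain ⟨c, hc, -⟩ := hpair j
      exact ⟨c, hc⟩
  have hge : Ropt K q θ + η ≤
      limsup (fun j => Real.logb q ((D j : Set (Fin (N j) → K)).ncard : ℝ) / (N j : ℝ)) atTop :=
    le_limsup_of_frequently_le (Eventually.of_forall hrate).frequently
      ⟨1, eventually_map.2 (Eventually.of_forall fun j => by
        exact logb_ncard_le_one hq hcard (D j : Set (Fin (N j) → K)))⟩
  linarith

end RateFunctions

section PackingBound

set_option linter.unusedSectionVars false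

variable {K : Type} [Field K] [Fintype K] [DecidableEq K]

open Polynomial in
/-- Sphere-packing-type estimate for the code defined by an irredundant family of parity
checks, with a radius slightly smaller than `ω` times the number of covered coordinates. -/
lemma exists_radius_packing {q n : ℕ} (hq : 2 ≤ q) (hcard : Fintype.card K = q) (hn : 1 ≤ n)
    {ω η : ℝ} (hω : 0 ≤ ω) (hη : 0 < η) :
    ∃ ε, 0 ≤ ε ∧ (ω = 0 ∨ 0 < ε) ∧ ε ≤ ω ∧ ∃ k₀ : ℕ,
      ∀ (ι γ : Type) [Fintype ι] [DecidableEq ι] [Fintype γ] [DecidableEq γ]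
        (h : γ → ι → K) (p : γ → ι), (∀ g, p g ∈ ownCoords h g) →
        (∀ g, (Finset.univ.filter fun i => h g i ≠ 0).card ≤ n) →
        k₀ ≤ (coveredCoords h).card → 0 < (coveredCoords h).card →
        Real.logb q ((checkCode h).card : ℝ) -
          Real.logb q ((((checkCode h).filter fun v => hammingNorm v ≤
            ⌊(ω - ε) * (coveredCoords h).card⌋₊).card : ℕ) : ℝ) ≤
          (coveredCoords h).card * (Rhat0 q n ω + η) := by
  have hq' : (1:ℝ) < q := by exact_mod_cast hq
  have hlogq : 0 < Real.log q := Real.log_pos hq'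
  have hQ : (1:ℝ) ≤ (Fintype.card K : ℝ) ^ n := one_le_pow₀ (by rw [hcard]; exact hq'.le)
  have hη' : 0 < η * Real.log q := mul_pos hη hlogq
  have htilt : ∃ ε, 0 ≤ ε ∧ (ω = 0 ∨ 0 < ε) ∧ ε ≤ ω ∧ ∃ k₀ : ℕ, ∀ k, k₀ ≤ k →
      ∀ (ι : Type) (G : Finset ι) (f : ι → ℝ[X]), G.card ≤ k →
      (∀ g ∈ G, IsWeightPoly (f g) n ((Fintype.card K : ℝ) ^ n)) →
      ∃ z : ℝ, 0 < z ∧ z ≤ 1 ∧ Real.log ((∏ g ∈ G, f g).eval z) - ω * k * Real.log z ≤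
        η * Real.log q * k +
          Real.log (∑ j ∈ Finset.range (⌊(ω - ε) * k⌋₊ + 1), (∏ g ∈ G, f g).coeff j) := by
    rcases hω.eq_or_lt with rfl | hpos
    · refine ⟨0, le_rfl, Or.inl rfl, le_rfl, 0, fun k _ ι G f hG hf => ?_⟩
      obtain ⟨z, hz, hz1, hle⟩ := exists_tilt_zero _ _ n hη' hQ k G f hG hf
      refine ⟨z, hz, hz1, ?_⟩
      have h1 : (∏ g ∈ G, f g).coeff 0 = 1 := by
        rw [coeff_zero_prod]
        exact Finset.prod_eq_one fun g hg => (hf g hg).coeff_zero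
      simp [h1]
      linarith
    · obtain ⟨ε, hε, hεω, k₀, H⟩ := exists_tilt_pos ω _ _ n hpos hη' hQ hn
      exact ⟨ε, hε.le, Or.inr hε, hεω, k₀, H⟩
  obtain ⟨ε, hε, hε', hεω, k₀, H⟩ := htilt
  refine ⟨ε, hε, hε', hεω, k₀, ?_⟩
  intro ι γ _ _ _ _ h p hp hsupp hk₀ hk
  set k := (coveredCoords h).card with hkdef
  have hsum := sum_card_ownCoords h
  have hown1 : ∀ g, 1 ≤ (ownCoords h g).card := fun g => Finset.card_pos.2 ⟨p g, hp g⟩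
  have hownn : ∀ g, (ownCoords h g).card ≤ n := fun g =>
    (Finset.card_le_card fun i hi => Finset.mem_filter.2
      ⟨Finset.mem_univ _, (Finset.mem_filter.1 hi).2.1⟩).trans (hsupp g)
  have hγk : Fintype.card γ ≤ k := by
    calc Fintype.card γ = ∑ g : γ, 1 := by simp
      _ ≤ ∑ g, (ownCoords h g).card := Finset.sum_le_sum fun g _ => hown1 g
      _ ≤ k := by omega
  obtain ⟨z, hz, hz1, hle⟩ := H k hk₀ γ Finset.univ
    (fun g => parityPoly fun i : ownCoords h g => h g (i : ι)) (by rwa [Finset.card_univ])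
    (fun g _ => isWeightPoly_parityPoly _ n (by rw [Fintype.card_coe]; exact hownn g))
  set r := ⌊(ω - ε) * k⌋₊
  set B := (checkCode h).filter fun v => hammingNorm v ≤ r
  have hsumpos : 1 ≤ ∑ j ∈ Finset.range (r + 1),
      (∏ g, parityPoly fun i : ownCoords h g => h g (i : ι)).coeff j := by
    have hw : ∀ g ∈ (Finset.univ : Finset γ),
        IsWeightPoly (parityPoly fun i : ownCoords h g => h g (i : ι)) n
          ((Fintype.card K : ℝ) ^ n) :=
      fun g _ => isWeightPoly_parityPoly _ n (by rw [Fintype.card_coe]; exact hownn g)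
    have h1 : (∏ g, parityPoly fun i : ownCoords h g => h g (i : ι)).coeff 0 = 1 := by
      rw [coeff_zero_prod]
      exact Finset.prod_eq_one fun g hg => (hw g hg).coeff_zero
    rw [← h1]
    exact Finset.single_le_sum (f := fun j =>
      (∏ g, parityPoly fun i : ownCoords h g => h g (i : ι)).coeff j)
      (fun j _ => coeff_prod_nonneg _ _ (fun g hg => (hw g hg).coeff_nonneg) j)
      (Finset.mem_range.2 (Nat.succ_pos r))
  have hB := sum_coeff_le_card_ball h r
  have heval : ∀ g, (parityPoly fun i : ownCoords h g => h g (i : ι)).eval z =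
      parityEnum q (ownCoords h g).card z := by
    intro g
    rw [eval_parityPoly _ (fun i => (Finset.mem_filter.1 i.2).2.1), Fintype.card_coe, hcard,
      parityEnum]
  have hlogB := Real.log_le_log (by linarith) hB
  have hlogeval : Real.log ((∏ g, parityPoly fun i : ownCoords h g => h g (i : ι)).eval z) =
      ∑ g, Real.log (parityEnum q (ownCoords h g).card z) := by
    rw [eval_prod, Real.log_prod]
    · exact Finset.sum_congr rfl fun g _ => by rw [heval]
    · intro g _
      rw [heval]
      have := one_le_parityEnum (s := (ownCoords h g).card) hq hz.le hz1
      linarith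
  have hpack := packing_le_Rhat0 (n := n) hq hω Finset.univ (fun g => (ownCoords h g).card) k
    (overlapCoords h).card (fun g _ => hown1 g) (fun g _ => hownn g) hsum hk
    (by rw [Finset.card_univ]; exact card_covered_add_card_overlap_le h n hsupp) hz hz1
  rw [Finset.card_univ] at hpack
  have hcc : Real.logb q ((checkCode h).card : ℝ) ≤ k - Fintype.card γ := by
    have hle := card_checkCode_le h p hp
    rw [hcard] at hle
    have hne : 0 < (checkCode h).card := Finset.card_pos.2 ⟨0, mem_checkCode.2 (by simp)⟩
    calc Real.logb q ((checkCode h).card : ℝ)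
        ≤ Real.logb q ((q:ℝ) ^ (k - Fintype.card γ)) :=
          Real.logb_le_logb_of_le hq' (by exact_mod_cast hne) (by exact_mod_cast hle)
      _ = k - Fintype.card γ := by
          rw [Real.logb_pow, Real.logb_self_eq_one hq', mul_one, Nat.cast_sub hγk]
  have hkey : ∑ g, Real.logb q (parityEnum q (ownCoords h g).card z) - ω * k * Real.logb q z ≤
      η * k + Real.logb q (B.card : ℝ) := by
    simp only [Real.logb, ← Finset.sum_div]
    rw [← sub_nonneg]
    have : 0 ≤ (η * Real.log q * k + Real.log (B.card : ℝ) -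
        (∑ g, Real.log (parityEnum q (ownCoords h g).card z) - ω * k * Real.log z)) /
          Real.log q := by
      refine div_nonneg ?_ hlogq.le
      rw [hlogeval] at hle
      linarith
    refine this.trans_eq ?_
    field_simp
  linarith

/-- A dense subcode all of whose words are close to each other on the covered coordinates. -/
lemma exists_close_subcode {ι γ : Type} [Fintype ι] [DecidableEq ι] [Fintype γ] [DecidableEq γ]
    (h : γ → ι → K) (C : Finset (ι → K)) (hC : ∀ c ∈ C, ∀ g, ∑ i, h g i * c i = 0) (r : ℕ) :
    ∃ D ⊆ C, C.card * ((checkCode h).filter fun v => hammingNorm v ≤ r).card ≤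
        (checkCode h).card * D.card ∧
      ∀ c ∈ D, ∀ c' ∈ D, hammingDist c c' ≤ 2 * r +
        hammingDist (fun i : {i // i ∉ coveredCoords h} => c i)
          (fun i : {i // i ∉ coveredCoords h} => c' i) := by
  set f : (ι → K) → ι → K := fun c i => if i ∈ coveredCoords h then c i else 0 with hf
  have hmem : ∀ c ∈ C, f c ∈ checkCode h := by
    intro c hc
    refine mem_checkCode.2 ⟨fun i hi => if_neg hi, fun g => ?_⟩
    rw [← hC c hc g]
    refine Finset.sum_congr rfl fun i _ => ?_
    by_cases hi : i ∈ coveredCoords h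
    · simp [hf, hi]
    · have : h g i = 0 := by
        by_contra hne
        exact hi (Finset.mem_filter.2 ⟨Finset.mem_univ _, g, hne⟩)
      simp [this]
  obtain ⟨v, -, hv⟩ := exists_dense_translate (checkCode h) ⟨0, mem_checkCode.2 (by simp)⟩
    (fun _ hu _ hv => sub_mem_checkCode hu hv) (fun x => hammingNorm x ≤ r) C f hmem
  refine ⟨_, Finset.filter_subset _ _, hv, fun c hc c' hc' => ?_⟩
  have h1 : hammingDist (f c) v ≤ r := by
    rw [hammingDist_comm, hammingDist_eq_hammingNorm, neg_add_eq_sub]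
    exact (Finset.mem_filter.1 hc).2
  have h2 : hammingDist (f c') v ≤ r := by
    rw [hammingDist_comm, hammingDist_eq_hammingNorm, neg_add_eq_sub]
    exact (Finset.mem_filter.1 hc').2
  have h3 : hammingDist (f c) (f c') ≤ 2 * r := by
    have := hammingDist_triangle (f c) v (f c')
    rw [hammingDist_comm v] at this
    omega
  refine le_trans ?_ (Nat.add_le_add_right h3 _)
  have hsub : (Finset.univ.filter fun i => c i ≠ c' i) ⊆
      (Finset.univ.filter fun i => f c i ≠ f c' i) ∪
        (Finset.univ.filter fun i : {i // i ∉ coveredCoords h} => c i ≠ c' i).map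
          (Function.Embedding.subtype _) := by
    intro i hi
    have hne := (Finset.mem_filter.1 hi).2
    by_cases hic : i ∈ coveredCoords h
    · refine Finset.mem_union_left _ (Finset.mem_filter.2 ⟨Finset.mem_univ _, ?_⟩)
      simpa [hf, hic] using hne
    · exact Finset.mem_union_right _ (Finset.mem_map.2
        ⟨⟨i, hic⟩, Finset.mem_filter.2 ⟨Finset.mem_univ _, hne⟩, rfl⟩)
  refine (Finset.card_le_card hsub).trans ((Finset.card_union_le _ _).trans ?_)
  rw [Finset.card_map]
  exact le_rfl

/-- Puncturing the covered coordinates of a dense subcode keeps its words apart. -/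
lemma exists_punctured_subcode {q : ℕ} (hq : 2 ≤ q) {ι γ : Type} [Fintype ι] [DecidableEq ι]
    [Fintype γ] [DecidableEq γ] (h : γ → ι → K) (C : Finset (ι → K)) (hne : C.Nonempty)
    (hC : ∀ c ∈ C, ∀ g, ∑ i, h g i * c i = 0) (r d : ℕ)
    (hd : ∀ c ∈ C, ∀ c' ∈ C, c ≠ c' → d ≤ hammingDist c c') (hr : 2 * r < d ∨ r = 0)
    {M : ℕ} (hM : M = Fintype.card ι - (coveredCoords h).card) :
    ∃ D : Finset (Fin M → K),
      (∀ c ∈ D, ∀ c' ∈ D, c ≠ c' → d ≤ 2 * r + hammingDist c c') ∧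
      Real.logb q (C.card : ℝ) ≤ Real.logb q ((checkCode h).card : ℝ) -
        Real.logb q ((((checkCode h).filter fun v => hammingNorm v ≤ r).card : ℕ) : ℝ) +
        Real.logb q (D.card : ℝ) := by
  have hq' : (1:ℝ) < q := by exact_mod_cast hq
  obtain ⟨D, hDC, hcard, hclose⟩ := exists_close_subcode h C hC r
  have hcompl : Fintype.card {i // i ∉ coveredCoords h} = M := by
    rw [Fintype.card_subtype_compl, Fintype.card_coe, hM]
  set e := Fintype.equivFinOfCardEq hcompl
  set f : (ι → K) → Fin M → K := fun c j => c (e.symm j) with hf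
  have hfdist : ∀ c c', hammingDist (f c) (f c') =
      hammingDist (fun i : {i // i ∉ coveredCoords h} => c i)
        (fun i : {i // i ∉ coveredCoords h} => c' i) := by
    intro c c'
    rw [hammingDist_eq_hammingNorm, hammingDist_eq_hammingNorm, ← hammingNorm_comp_equiv e.symm]
    rfl
  have hinj : Set.InjOn f D := by
    intro c hc c' hc' hcc
    by_contra hcon
    have h1 := hclose c hc c' hc'
    rw [← hfdist, hcc, hammingDist_self] at h1
    have h2 := hd c (hDC hc) c' (hDC hc') hcon
    have h3 := hammingDist_pos.2 hcon
    omega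
  refine ⟨D.image f, ?_, ?_⟩
  · intro x hx x' hx' hxx
    obtain ⟨c, hc, rfl⟩ := Finset.mem_image.1 hx
    obtain ⟨c', hc', rfl⟩ := Finset.mem_image.1 hx'
    have hcc : c ≠ c' := fun hcc => hxx (by rw [hcc])
    rw [hfdist]
    exact (hd c (hDC hc) c' (hDC hc') hcc).trans (hclose c hc c' hc')
  · rw [Finset.card_image_of_injOn hinj]
    have hCpos : 0 < C.card := Finset.card_pos.2 hne
    have h0 : (0 : ι → K) ∈ checkCode h := mem_checkCode.2 (by simp)
    have hVpos : 0 < (checkCode h).card := Finset.card_pos.2 ⟨0, h0⟩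
    have hBpos : 0 < ((checkCode h).filter fun v => hammingNorm v ≤ r).card :=
      Finset.card_pos.2 ⟨0, Finset.mem_filter.2 ⟨h0, by simp⟩⟩
    have hDpos : 0 < D.card := by
      by_contra hcon
      have hD0 : D.card = 0 := by omega
      rw [hD0, mul_zero] at hcard
      exact absurd (Nat.mul_pos hCpos hBpos) (not_lt.2 hcard)
    have hlog : Real.logb q ((C.card : ℝ) *
        (((checkCode h).filter fun v => hammingNorm v ≤ r).card : ℕ)) ≤
        Real.logb q (((checkCode h).card : ℝ) * D.card) :=
      Real.logb_le_logb_of_le hq' (by positivity) (by exact_mod_cast hcard)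
    rw [Real.logb_mul (by positivity) (by positivity),
      Real.logb_mul (by positivity) (by positivity)] at hlog
    linarith

/-- A linearly recoverable code satisfies an irredundant family of parity checks of small
support covering approximately a prescribed number of coordinates. -/
lemma IsLinRecLRC.exists_checks {N n : ℕ} {C : Set (Fin N → K)} {Rg : Fin N → Finset (Fin N)}
    (hC : IsLinRecLRC C n Rg) (x : ℝ) (hx0 : 0 ≤ x) (hx : x < N) :
    ∃ (γ : Type) (_ : Fintype γ) (_ : DecidableEq γ) (h : γ → Fin N → K) (p : γ → Fin N),
      (∀ g, p g ∈ ownCoords h g) ∧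
      (∀ g, (Finset.univ.filter fun i => h g i ≠ 0).card ≤ n) ∧
      (∀ c ∈ C, ∀ g, ∑ i, h g i * c i = 0) ∧
      ((coveredCoords h).card : ℝ) ≤ x ∧ x < (coveredCoords h).card + n := by
  choose hmem hcard a ha hrec using hC
  set H : Fin N → Fin N → K := fun j i => (if i = j then 1 else 0) - a j i with hH
  set A : Fin N → Finset (Fin N) := fun j => Finset.univ.filter fun i => H j i ≠ 0 with hA
  have hAmem : ∀ j, j ∈ A j := by
    intro j
    have : a j j = 0 := ha j j (Finset.notMem_erase _ _)
    simp [hA, hH, this]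
  have hAcard : ∀ j, (A j).card ≤ n := by
    refine fun j => (Finset.card_le_card fun i hi => ?_).trans (hcard j)
    by_contra hcon
    have hij : i ≠ j := fun e => hcon (e ▸ hmem j)
    have : a j i = 0 := ha j i fun he => hcon (Finset.mem_of_mem_erase he)
    exact (Finset.mem_filter.1 hi).2 (by simp [hH, hij, this])
  obtain ⟨G, hG, hpriv⟩ := exists_irredundant_cover A hAmem
  obtain ⟨G', hG', hle, hlt⟩ := exists_subfamily_card A G hG n (fun g _ => hAcard g) x hx0
    (by rwa [Fintype.card_fin])
  have hcov : coveredCoords (fun g : G' => H g) = G'.biUnion A := by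
    ext i
    simp [coveredCoords, hA]
  choose! p hpA hpriv' using hpriv
  refine ⟨G', inferInstance, inferInstance, fun g => H g, fun g => p g, fun g => ?_,
    fun g => hAcard g, fun c hc g => ?_, by rwa [hcov], by rwa [hcov]⟩
  · refine Finset.mem_filter.2 ⟨Finset.mem_univ _,
      (Finset.mem_filter.1 (hpA g (hG' g.2))).2, fun g' hne => ?_⟩
    by_contra hcon
    exact hpriv' g (hG' g.2) g' (hG' g'.2) (fun e => hne (Subtype.ext e))
      (Finset.mem_filter.2 ⟨Finset.mem_univ _, hcon⟩)
  · simp only [hH, sub_mul, Finset.sum_sub_distrib, ite_mul, one_mul, zero_mul,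
      Finset.sum_ite_eq', Finset.mem_univ, if_true]
    rw [hrec g c hc, sub_self]

end PackingBound

/-- Theorem (general case, bound `R̂_1`): the rate of every linearly recoverable
`(δ,n)`-LRC sequence over `F` (not necessarily all-disjoint) is bounded from above by
`R̂_1(δ,n) = inf_{τ,θ,θ'} { τ·R̂_0(θ/2,n) + (1-τ)·R_opt(θ') }`, the infimum being over
`τ ∈ (0,1)` and `(θ,θ') ∈ [0,(q-1)/q]²` with `τθ + (1-τ)θ' = δ`. -/
theorem bound1_nondisjoint
    (K : Type) [Field K] [Fintype K] [DecidableEq K]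
    (q : ℕ) (hq : Fintype.card K = q)
    (n : ℕ) (hn : 2 ≤ n)
    (δ : ℝ) (hδ : δ ∈ Set.Ico (0:ℝ) (((q:ℝ) - 1) / q))
    -- the given linearly recoverable `(δ,n)`-LRC sequence
    (N : ℕ → ℕ) (C : ∀ i : ℕ, Set (Fin (N i) → K))
    (hmono : StrictMono N) (hne : ∀ i, (C i).Nonempty)
    (hLRC : ∀ i, ∃ Rg : Fin (N i) → Finset (Fin (N i)), IsLinRecLRC (C i) n Rg)
    (hdist : δ ≤ liminf (fun i => (minDist (C i) : ℝ) / (N i : ℝ)) atTop)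
    -- an arbitrary admissible triple `(τ, θ, θ')`
    (τ θ θ' : ℝ) (hτ : τ ∈ Set.Ioo (0:ℝ) 1)
    (hθ : θ ∈ Set.Icc (0:ℝ) (((q:ℝ) - 1) / q))
    (hθ' : θ' ∈ Set.Icc (0:ℝ) (((q:ℝ) - 1) / q))
    (hcombo : τ * θ + (1 - τ) * θ' = δ) :
    limsup (fun i => Real.logb q ((C i).ncard : ℝ) / (N i : ℝ)) atTop
      ≤ τ * Rhat0 q n (θ / 2) + (1 - τ) * Ropt K q θ' := by
  have hq2 : 2 ≤ q := hq ▸ Fintype.one_lt_card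
  have hq' : (1:ℝ) < q := by exact_mod_cast hq2
  obtain ⟨hτ0, hτ1⟩ := hτ
  obtain ⟨hθ0, -⟩ := hθ
  obtain ⟨hθ'0, hθ'q⟩ := hθ'
  have hθ'1 : θ' ≤ 1 := hθ'q.trans (div_le_one_of_le₀ (by linarith) (by linarith))
  have hRhat : 0 ≤ Rhat0 q n (θ / 2) := Rhat0_nonneg hq2 n (θ / 2)
  have hRopt : 0 ≤ Ropt K q θ' := Ropt_nonneg hq2 hq θ'
  refine le_of_forall_pos_le_add fun e he => ?_
  obtain ⟨ε, hε0, hεpos, hεω, k₀, hpack⟩ := exists_radius_packing (K := K) (n := n)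
    hq2 hq (by omega) (ω := θ / 2) (η := e / 2) (by linarith) (by linarith)
  obtain ⟨ε₂, hε₂, M₀, hopt⟩ := exists_Ropt_uniform (K := K) hq2 hq θ' (e / 2) (by linarith)
  have h1τ : 0 < 1 - τ := by linarith
  obtain ⟨ε₃, hε₃, hε₃2, hε₃1⟩ : ∃ ε₃ : ℝ, 0 < ε₃ ∧ ε₃ ≤ ε₂ * (1 - τ) / 2 ∧
      (0 < ε → ε₃ ≤ ε * τ) := by
    by_cases hε : 0 < ε
    · exact ⟨min (ε₂ * (1 - τ) / 2) (ε * τ), lt_min (by positivity) (by positivity),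
        min_le_left _ _, fun _ => min_le_right _ _⟩
    · exact ⟨ε₂ * (1 - τ) / 2, by positivity, le_rfl, fun h => absurd h hε⟩
  have hdev : ∀ᶠ i in atTop, δ - ε₃ < (minDist (C i) : ℝ) / (N i : ℝ) := by
    refine eventually_lt_of_lt_liminf (by linarith) ?_
    exact ⟨0, eventually_map.2 (Eventually.of_forall fun i => by positivity)⟩
  have hN : Tendsto (fun i => (N i : ℝ)) atTop atTop :=
    tendsto_natCast_atTop_atTop.comp hmono.tendsto_atTop
  refine limsup_le_of_le
    (IsBoundedUnder.isCoboundedUnder_le ⟨0, eventually_map.2 (Eventually.of_forall fun i => by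
      exact logb_ncard_nonneg hq2 (C i))⟩) ?_
  filter_upwards [hdev, hN.eventually_ge_atTop 1, hN.eventually_ge_atTop ((k₀ + 1 + n) / τ),
    hN.eventually_ge_atTop (M₀ / (1 - τ)), hN.eventually_ge_atTop (2 * n / (ε₂ * (1 - τ))),
    hN.eventually_ge_atTop (n * (Ropt K q θ' + e / 2) / (e / 2))]
    with i hdi hN1 hNk hNM hNε hNη
  have hNpos : (0:ℝ) < N i := by linarith
  rw [lt_div_iff₀ hNpos] at hdi
  rw [div_le_iff₀ hτ0] at hNk
  rw [div_le_iff₀ h1τ] at hNM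
  rw [div_le_iff₀ (by positivity)] at hNε
  rw [div_le_iff₀ (by positivity)] at hNη
  obtain ⟨Rg, hRg⟩ := hLRC i
  obtain ⟨γ, _, _, h, p, hp, hsupp, hchk, hk1, hk2⟩ :=
    hRg.exists_checks (τ * N i) (by positivity) (by nlinarith)
  set k := (coveredCoords h).card with hk
  have hk₀ : k₀ + 1 ≤ k := by
    have : ((k₀ + 1 : ℕ) : ℝ) < k + 1 := by push_cast; linarith
    have : k₀ + 1 < k + 1 := by exact_mod_cast this
    omega
  have hpk := hpack (Fin (N i)) γ h p hp hsupp (by omega) (by omega)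
  rw [← hk] at hpk
  set r := ⌊(θ / 2 - ε) * k⌋₊ with hr
  have hr2 : 2 * (r : ℝ) ≤ (θ - 2 * ε) * (τ * N i) := by
    have h1 : (r : ℝ) ≤ (θ / 2 - ε) * k :=
      Nat.floor_le (mul_nonneg (by linarith) (Nat.cast_nonneg k))
    have h2 : (θ / 2 - ε) * k ≤ (θ / 2 - ε) * (τ * N i) :=
      mul_le_mul_of_nonneg_left hk1 (by linarith)
    linarith
  have hfin : (C i).Finite := Set.toFinite _
  have hrd : 2 * r < minDist (C i) ∨ r = 0 := by
    rcases hεpos with hω | hε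
    · right
      have : ε = 0 := by linarith
      rw [hr, hω, this]
      simp
    · left
      have h3 := hε₃1 hε
      have h4 : 0 < ε * τ := by positivity
      have h5 : (θ - 2 * ε) * τ ≤ δ - ε₃ := by
        rw [← hcombo]
        nlinarith [mul_nonneg h1τ.le hθ'0]
      have : (2 * (r:ℝ)) < minDist (C i) := by
        nlinarith [mul_le_mul_of_nonneg_right h5 hNpos.le]
      exact_mod_cast this
  obtain ⟨M, hM⟩ : ∃ M, M = Fintype.card (Fin (N i)) - (coveredCoords h).card := ⟨_, rfl⟩
  obtain ⟨D, hDdist, hDlog⟩ := exists_punctured_subcode hq2 h hfin.toFinset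
    (by simpa using hne i) (fun c hc => hchk c (by simpa using hc)) r (minDist (C i))
    (fun c hc c' hc' hcc => minDist_le_hammingDist (by simpa using hc) (by simpa using hc') hcc)
    hrd hM
  rw [← Set.ncard_eq_toFinset_card (C i) hfin] at hDlog
  have hkN : k ≤ N i := by
    have : (k : ℝ) ≤ N i := by nlinarith
    exact_mod_cast this
  have hMR : (M : ℝ) = N i - k := by
    rw [hM, Fintype.card_fin, Nat.cast_sub hkN]
  have hD := hopt M (by
    have : (M₀ : ℝ) ≤ M := by rw [hMR]; linarith
    exact_mod_cast this) D fun c hc c' hc' hcc => by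
      have h1 : (minDist (C i) : ℝ) ≤ 2 * r + hammingDist c c' := by
        exact_mod_cast hDdist c hc c' hc' hcc
      have hM1 : (1 - τ) * N i ≤ M := by rw [hMR]; linarith
      have hM2 : (M : ℝ) ≤ (1 - τ) * N i + n := by rw [hMR]; linarith
      have h2 : θ' * M ≤ θ' * ((1 - τ) * N i) + n := by
        have := mul_le_mul_of_nonneg_left hM2 hθ'0
        have : θ' * n ≤ 1 * n := mul_le_mul_of_nonneg_right hθ'1 (Nat.cast_nonneg n)
        linarith
      have h3 : ε₂ * ((1 - τ) * N i) ≤ ε₂ * M := mul_le_mul_of_nonneg_left hM1 hε₂.le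
      have h4 : ε₃ * N i ≤ ε₂ * (1 - τ) / 2 * N i := mul_le_mul_of_nonneg_right hε₃2 hNpos.le
      have h5 : 0 ≤ ε * (τ * N i) := by positivity
      rw [← hcombo] at hdi
      linarith
  rw [div_le_iff₀ hNpos]
  have hfin1 : k * (Rhat0 q n (θ / 2) + e / 2) ≤ τ * N i * (Rhat0 q n (θ / 2) + e / 2) :=
    mul_le_mul_of_nonneg_right hk1 (by positivity)
  have hfin2 : (Ropt K q θ' + e / 2) * M ≤
      (Ropt K q θ' + e / 2) * ((1 - τ) * N i + n) :=
    mul_le_mul_of_nonneg_left (by rw [hMR]; linarith) (by positivity)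
  linarith
end
end

section
/- Let q be a prime power, F the finite field with q elements, and n ≥ 2 an integer. Let 𝒞 be the [n, n-1, 2] parity code over F (the linear code of all words in F^n whose coordinates sum to zero). Then: (i) the weight enumerator of 𝒞 is W_𝒞(z) = (1/q)·[ (1+(q-1)z)^n + (q-1)(1-z)^n ]; (ii) (1/n)·log_q α_𝒞(ω) = λ_q(ω,n) for every ω ≥ 0; and (iii) the mapping ω ↦ λ_q(ω,n) takes the value 0 at ω = 0, is strictly increasing on [0,(q-1)/q], takes the value (n-1)/n at ω = (q-1)/q, and is constantly (n-1)/n for all ω ≥ (q-1)/q. -/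
open Set

noncomputable section

/-- The weight enumerator polynomial `W_𝒞(z) = Σ_{i=0}^n W_i·z^i` of a linear code
`𝒞 ⊆ F^n`, where `W_i` is the number of codewords of Hamming weight `i`. -/
def weightEnum {K : Type} [Field K] [Fintype K] [DecidableEq K]
    (n : ℕ) (Cc : Submodule K (Fin n → K)) (z : ℝ) : ℝ :=
  ∑ i ∈ Finset.range (n + 1),
    (({c : Fin n → K | c ∈ Cc ∧ hammingNorm c = i}).ncard : ℝ) * z ^ i

/-- `α_𝒞(ω) = inf_{z∈(0,1]} z^{-nω}·W_𝒞(z)`. -/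
def alphaC {K : Type} [Field K] [Fintype K] [DecidableEq K]
    (n : ℕ) (Cc : Submodule K (Fin n → K)) (ω : ℝ) : ℝ :=
  ⨅ z : Set.Ioc (0:ℝ) 1, ((z : ℝ) ^ (-((n : ℝ) * ω))) * weightEnum n Cc z

lemma pow_hammingNorm_cons {K : Type*} [Field K] [DecidableEq K] {n : ℕ} (a : K)
    (c : Fin n → K) (z : ℝ) :
    z ^ hammingNorm (Fin.cons a c : Fin (n + 1) → K) =
      (if a = 0 then 1 else z) * z ^ hammingNorm c := by
  have h (m : ℕ) (x : Fin m → K) : z ^ hammingNorm x = ∏ i, if x i = 0 then 1 else z := by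
    simp [hammingNorm, Finset.prod_ite]
  rw [h, h, Fin.prod_univ_succ]
  simp

/-- The weight enumerator of the words of `K ^ n` whose coordinates sum to `s`. -/
lemma sum_pow_hammingNorm_of_sum_eq {K : Type*} [Field K] [Fintype K] [DecidableEq K]
    (n : ℕ) (z : ℝ) (s : K) :
    ∑ c : Fin n → K, (if ∑ i, c i = s then z ^ hammingNorm c else 0) =
      (1 / (Fintype.card K : ℝ)) * ((1 + ((Fintype.card K : ℝ) - 1) * z) ^ n +
        ((if s = 0 then (Fintype.card K : ℝ) else 0) - 1) * (1 - z) ^ n) := by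
  have hK : (Fintype.card K : ℝ) ≠ 0 := by simp
  induction n generalizing s with
  | zero =>
    by_cases hs : s = 0
    · subst hs; simp [hammingNorm, hK]
    · simp [hs, Ne.symm hs]
  | succ n ih =>
    rw [← (Fin.consEquiv (fun _ => K)).sum_comp, Fintype.sum_prod_type]
    have key (a : K) : ∑ c : Fin n → K,
        (if ∑ i, (Fin.consEquiv (fun _ => K)) (a, c) i = s then
          z ^ hammingNorm ((Fin.consEquiv (fun _ => K)) (a, c)) else 0) =
        (if a = 0 then 1 - z else 0) * ∑ c : Fin n → K,
          (if ∑ i, c i = s then z ^ hammingNorm c else 0) +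
        z * ∑ c : Fin n → K, (if ∑ i, c i = s - a then z ^ hammingNorm c else 0) := by
      simp only [Fin.consEquiv, Equiv.coe_fn_mk, Fin.sum_univ_succ, Fin.cons_zero, Fin.cons_succ,
        pow_hammingNorm_cons, eq_sub_iff_add_eq', Finset.mul_sum, ← Finset.sum_add_distrib]
      refine Finset.sum_congr rfl fun c _ => ?_
      by_cases ha : a = 0
      · subst ha; simp only [zero_add, if_true]; split_ifs <;> ring
      · simp [ha]
    simp only [key, ih, Finset.sum_add_distrib, ← Finset.sum_mul, ← Finset.mul_sum,
      Finset.sum_sub_distrib, sub_eq_zero, Finset.sum_ite_eq, Finset.sum_ite_eq',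
      Finset.mem_univ, if_true, Finset.sum_const, Finset.card_univ, nsmul_eq_mul]
    field_simp
    ring

lemma weightEnum_eq_sum {K : Type} [Field K] [Fintype K] [DecidableEq K]
    (n : ℕ) (Cc : Submodule K (Fin n → K)) [DecidablePred (· ∈ Cc)] (z : ℝ) :
    weightEnum n Cc z = ∑ c : Fin n → K, if c ∈ Cc then z ^ hammingNorm c else 0 := by
  have h (i : ℕ) : (({c : Fin n → K | c ∈ Cc ∧ hammingNorm c = i}).ncard : ℝ) * z ^ i =
      ∑ c ∈ {c : Fin n → K | c ∈ Cc} with hammingNorm c = i, z ^ hammingNorm c := by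
    rw [Finset.sum_congr rfl fun c hc => by rw [(Finset.mem_filter.1 hc).2],
      Finset.sum_const, nsmul_eq_mul, Finset.filter_filter, ← Set.ncard_coe_finset]
    simp
  rw [weightEnum, Finset.sum_congr rfl fun i _ => h i, Finset.sum_fiberwise_of_maps_to,
    Finset.sum_filter]
  intro c _
  have := hammingNorm_le_card_fintype (x := c)
  simp only [Fintype.card_fin] at this
  exact Finset.mem_range.2 (by omega)

/-- The numerator `q · W(z)` of the weight enumerator of the parity code. -/
def parityNum (q n : ℕ) (z : ℝ) : ℝ :=
  (1 + ((q : ℝ) - 1) * z) ^ n + ((q : ℝ) - 1) * (1 - z) ^ n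

lemma le_parityNum {q n : ℕ} (hq : 2 ≤ q) {z : ℝ} (hz : z ∈ Ioc (0 : ℝ) 1) :
    (q : ℝ) ≤ parityNum q n z := by
  have hq' : (2 : ℝ) ≤ q := by exact_mod_cast hq
  have h₁ := one_add_mul_le_pow (a := ((q : ℝ) - 1) * z) (by nlinarith [hz.1]) n
  have h₂ := one_add_mul_le_pow (a := -z) (by linarith [hz.2]) n
  have h₃ := mul_le_mul_of_nonneg_left h₂ (show (0 : ℝ) ≤ (q : ℝ) - 1 by linarith)
  rw [← sub_eq_add_neg] at h₃
  unfold parityNum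
  linarith

/-- The function of `z` whose infimum over `(0, 1]` is `lambdaQ q ω n`. -/
def lambdaFun (q n : ℕ) (ω z : ℝ) : ℝ :=
  -ω * Real.logb q z - 1 / n + (1 / n) * Real.logb q (parityNum q n z)

lemma lambdaQ_eq_iInf (q n : ℕ) (ω : ℝ) :
    lambdaQ q ω n = ⨅ z : Ioc (0 : ℝ) 1, lambdaFun q n ω z := rfl

lemma lambdaFun_nonneg {q n : ℕ} (hq : 2 ≤ q) {ω z : ℝ} (hω : 0 ≤ ω)
    (hz : z ∈ Ioc (0 : ℝ) 1) : 0 ≤ lambdaFun q n ω z := by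
  have hq' : (1 : ℝ) < q := by exact_mod_cast hq
  have h₁ : Real.logb q z ≤ 0 := Real.logb_nonpos hq' hz.1.le hz.2
  have h₂ : 1 ≤ Real.logb q (parityNum q n z) := by
    rw [Real.le_logb_iff_rpow_le hq' (by linarith [le_parityNum (n := n) hq hz]), Real.rpow_one]
    exact le_parityNum hq hz
  have h₃ : (0 : ℝ) ≤ 1 / n := by positivity
  unfold lambdaFun
  nlinarith [mul_nonneg hω (neg_nonneg.2 h₁), mul_nonneg h₃ (sub_nonneg.2 h₂)]

lemma bddBelow_range_lambdaFun {q : ℕ} (n : ℕ) (hq : 2 ≤ q) {ω : ℝ} (hω : 0 ≤ ω) :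
    BddBelow (range fun z : Ioc (0 : ℝ) 1 => lambdaFun q n ω z) :=
  ⟨0, by rintro _ ⟨z, rfl⟩; exact lambdaFun_nonneg hq hω z.2⟩

lemma lambdaQ_le_s19 {q : ℕ} (n : ℕ) (hq : 2 ≤ q) {ω z : ℝ} (hω : 0 ≤ ω)
    (hz : z ∈ Ioc (0 : ℝ) 1) : lambdaQ q ω n ≤ lambdaFun q n ω z :=
  ciInf_le (bddBelow_range_lambdaFun n hq hω) ⟨z, hz⟩

instance : Nonempty (Ioc (0 : ℝ) 1) := ⟨⟨1, by simp⟩⟩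

lemma lambdaFun_one {q n : ℕ} (hq : 2 ≤ q) (hn : n ≠ 0) (ω : ℝ) :
    lambdaFun q n ω 1 = ((n : ℝ) - 1) / n := by
  have hq' : (1 : ℝ) < q := by exact_mod_cast hq
  have : Real.logb q (q : ℝ) = 1 := Real.logb_self_eq_one hq'
  have hn' : (n : ℝ) ≠ 0 := by exact_mod_cast hn
  simp [lambdaFun, parityNum, hn, Real.logb_pow, this]
  field_simp
  ring

lemma rpow_lambdaFun {q n : ℕ} (hq : 2 ≤ q) (hn : n ≠ 0) (ω : ℝ) {z : ℝ}
    (hz : z ∈ Ioc (0 : ℝ) 1) :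
    (q : ℝ) ^ ((n : ℝ) * lambdaFun q n ω z) =
      z ^ (-((n : ℝ) * ω)) * (1 / (q : ℝ) * parityNum q n z) := by
  have hq' : (1 : ℝ) < q := by exact_mod_cast hq
  have hq0 : (0 : ℝ) < q := by linarith
  have hn' : (n : ℝ) ≠ 0 := by exact_mod_cast hn
  have hP : 0 < parityNum q n z := hq0.trans_le (le_parityNum hq hz)
  have h : (n : ℝ) * lambdaFun q n ω z =
      Real.logb q z * (-((n : ℝ) * ω)) + (-1) + Real.logb q (parityNum q n z) := by
    unfold lambdaFun; field_simp; ring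
  rw [h, Real.rpow_add hq0, Real.rpow_add hq0, Real.rpow_mul hq0.le,
    Real.rpow_logb hq0 hq'.ne' hz.1, Real.rpow_logb hq0 hq'.ne' hP, Real.rpow_neg_one]
  ring

lemma logb_iInf_eq {q n : ℕ} (hq : 2 ≤ q) (hn : n ≠ 0) {ω : ℝ} (hω : 0 ≤ ω) :
    (1 / (n : ℝ)) * Real.logb q (⨅ z : Ioc (0 : ℝ) 1,
      (z : ℝ) ^ (-((n : ℝ) * ω)) * (1 / (q : ℝ) * parityNum q n z)) = lambdaQ q ω n := by
  have hq' : (1 : ℝ) < q := by exact_mod_cast hq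
  have hn' : (n : ℝ) ≠ 0 := by exact_mod_cast hn
  have hmono : Monotone fun x : ℝ => (q : ℝ) ^ ((n : ℝ) * x) := fun x y hxy =>
    Real.rpow_le_rpow_of_exponent_le hq'.le (by gcongr)
  have hcont : Continuous fun x : ℝ => (q : ℝ) ^ ((n : ℝ) * x) :=
    Continuous.rpow (by fun_prop) (by fun_prop) fun _ => Or.inl (by linarith)
  have h := hmono.map_ciInf_of_continuousAt hcont.continuousAt
    (bddBelow_range_lambdaFun n hq hω)
  rw [lambdaQ_eq_iInf, ← iInf_congr fun z : Ioc (0 : ℝ) 1 => rpow_lambdaFun hq hn ω z.2, ← h,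
    Real.logb_rpow (by linarith) hq'.ne']
  field_simp

lemma lambdaQ_zero {q : ℕ} (n : ℕ) (hq : 2 ≤ q) : lambdaQ q 0 n = 0 := by
  have hq' : (1 : ℝ) < q := by exact_mod_cast hq
  refine le_antisymm ?_ (le_ciInf fun z => lambdaFun_nonneg hq le_rfl z.2)
  have hcont : ContinuousAt (fun z => lambdaFun q n 0 z) 0 := by
    simp only [lambdaFun, parityNum, neg_zero, zero_mul]
    refine continuousAt_const.add (continuousAt_const.mul ?_)
    simp only [Real.logb]
    refine (ContinuousAt.log (by fun_prop) ?_).div_const _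
    simp; linarith
  have h0 : lambdaFun q n 0 0 = 0 := by
    simp [lambdaFun, parityNum, Real.logb_self_eq_one hq']
  have ht := hcont.tendsto.mono_left (nhdsWithin_le_nhds (s := Ioi 0))
  rw [h0] at ht
  refine ge_of_tendsto ht ?_
  filter_upwards [Ioc_mem_nhdsGT (zero_lt_one' ℝ)] with z hz
  exact lambdaQ_le_s19 n hq le_rfl hz

lemma lambdaQ_of_ge {q n : ℕ} (hq : 2 ≤ q) (hn : n ≠ 0) {ω : ℝ}
    (hω : ((q : ℝ) - 1) / q ≤ ω) : lambdaQ q ω n = ((n : ℝ) - 1) / n := by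
  have hq' : (1 : ℝ) < q := by exact_mod_cast hq
  have hq0 : (0 : ℝ) < q := by linarith
  have hω0 : 0 ≤ ω := (div_nonneg (by linarith) hq0.le).trans hω
  have hn0 : (0 : ℝ) < n := by exact_mod_cast Nat.pos_of_ne_zero hn
  refine le_antisymm ((lambdaQ_le_s19 n hq hω0 (by simp)).trans_eq (lambdaFun_one hq hn ω))
    (le_ciInf fun ⟨z, hz⟩ => ?_)
  have hamgm := Real.geom_mean_le_arith_mean2_weighted (w₁ := 1 / q) (w₂ := ((q : ℝ) - 1) / q)
    (p₁ := 1) (p₂ := z) (by positivity) (div_nonneg (by linarith) hq0.le) zero_le_one hz.1.le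
    (by field_simp; ring)
  have hpos : 0 < 1 + ((q : ℝ) - 1) * z := by nlinarith [hz.1]
  have h₁ : (q : ℝ) * z ^ (((q : ℝ) - 1) / q) ≤ 1 + ((q : ℝ) - 1) * z := by
    rw [Real.one_rpow, one_mul] at hamgm
    calc _ ≤ (q : ℝ) * (1 / q * 1 + ((q : ℝ) - 1) / q * z) := by gcongr
      _ = _ := by field_simp
  have h₂ : 1 + ((q : ℝ) - 1) / q * Real.logb q z ≤ Real.logb q (1 + ((q : ℝ) - 1) * z) := by
    have hzr : 0 < z ^ (((q : ℝ) - 1) / q) := Real.rpow_pos_of_pos hz.1 _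
    have := Real.logb_le_logb_of_le hq' (by positivity) h₁
    rwa [Real.logb_mul hq0.ne' hzr.ne', Real.logb_self_eq_one hq',
      Real.logb_rpow_eq_mul_logb_of_pos hz.1] at this
  have h₃ : (n : ℝ) * Real.logb q (1 + ((q : ℝ) - 1) * z) ≤ Real.logb q (parityNum q n z) := by
    rw [← Real.logb_pow]
    refine Real.logb_le_logb_of_le hq' (by positivity) ?_
    exact le_add_of_nonneg_right
      (mul_nonneg (by linarith) (pow_nonneg (by linarith [hz.2]) n))
  have h₄ : Real.logb q z ≤ 0 := Real.logb_nonpos hq' hz.1.le hz.2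
  have h₅ : Real.logb q (1 + ((q : ℝ) - 1) * z) ≤ 1 / n * Real.logb q (parityNum q n z) := by
    rw [one_div, ← div_eq_inv_mul, le_div_iff₀ hn0]; linarith
  have h₆ : ((n : ℝ) - 1) / n = 1 - 1 / n := by field_simp
  show _ ≤ lambdaFun q n ω z
  unfold lambdaFun
  nlinarith [mul_nonneg (sub_nonneg.2 hω) (neg_nonneg.2 h₄)]

lemma hasDerivAt_lambdaFun_one {q n : ℕ} (hq : 2 ≤ q) (hn : 2 ≤ n) (ω : ℝ) :
    HasDerivAt (lambdaFun q n ω) ((((q : ℝ) - 1) / q - ω) / Real.log q) 1 := by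
  have hq' : (1 : ℝ) < q := by exact_mod_cast hq
  have hlog : Real.log q ≠ 0 := (Real.log_pos hq').ne'
  have hn0 : (n : ℝ) ≠ 0 := by positivity
  have hq0 : (q : ℝ) ≠ 0 := by positivity
  have hP1 : parityNum q n 1 = (q : ℝ) ^ n := by
    simp [parityNum, show n ≠ 0 by omega]
  have hP : HasDerivAt (parityNum q n) (n * (q : ℝ) ^ (n - 1) * ((q : ℝ) - 1)) 1 := by
    have h₁ := ((((hasDerivAt_id (1 : ℝ)).const_mul ((q : ℝ) - 1)).const_add 1).fun_pow n).fun_add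
      ((((hasDerivAt_id (1 : ℝ)).const_sub 1).fun_pow n).const_mul ((q : ℝ) - 1))
    refine h₁.congr_deriv ?_
    simp [show n - 1 ≠ 0 by omega]
  have h := ((((Real.hasDerivAt_log one_ne_zero).div_const (Real.log q)).const_mul (-ω)).sub_const
    (1 / (n : ℝ))).fun_add (((hP.log (by rw [hP1]; positivity)).div_const (Real.log q)).const_mul
      (1 / (n : ℝ)))
  refine h.congr_deriv ?_
  obtain ⟨m, rfl⟩ : ∃ m, n = m + 1 := ⟨n - 1, by omega⟩
  rw [hP1, Nat.add_sub_cancel, pow_succ]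
  field_simp
  ring

lemma lambdaQ_lt {q n : ℕ} (hq : 2 ≤ q) (hn : 2 ≤ n) {ω : ℝ} (hω0 : 0 ≤ ω)
    (hω : ω < ((q : ℝ) - 1) / q) : lambdaQ q ω n < ((n : ℝ) - 1) / n := by
  have hq' : (1 : ℝ) < q := by exact_mod_cast hq
  have hd := hasDerivAt_lambdaFun_one hq hn ω
  have hpos : 0 < (((q : ℝ) - 1) / q - ω) / Real.log q :=
    div_pos (sub_pos.2 hω) (Real.log_pos hq')
  have hslope := (hasDerivAt_iff_tendsto_slope.1 hd).mono_left
    (nhdsWithin_mono (1 : ℝ) (t := {1}ᶜ) (s := Iio 1) fun x hx => ne_of_lt hx)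
  obtain ⟨z, hz, hz01⟩ := ((hslope.eventually_const_lt hpos).and
    (Ioo_mem_nhdsLT (zero_lt_one' ℝ))).exists
  rw [slope_comm, slope_def_field, div_pos_iff_of_pos_right (sub_pos.2 hz01.2),
    lambdaFun_one hq (by omega)] at hz
  exact (lambdaQ_le_s19 n hq hω0 ⟨hz01.1, hz01.2.le⟩).trans_lt (sub_pos.1 hz)

lemma concaveOn_lambdaQ {q : ℕ} (n : ℕ) (hq : 2 ≤ q) :
    ConcaveOn ℝ (Ici 0) fun ω => lambdaQ q ω n := by
  refine ⟨convex_Ici 0, fun x hx y hy a b ha hb hab => le_ciInf fun z => ?_⟩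
  have h₁ := mul_le_mul_of_nonneg_left (lambdaQ_le_s19 n hq hx z.2) ha
  have h₂ := mul_le_mul_of_nonneg_left (lambdaQ_le_s19 n hq hy z.2) hb
  show a • lambdaQ q x n + b • lambdaQ q y n ≤ lambdaFun q n (a • x + b • y) z
  simp only [smul_eq_mul]
  refine (add_le_add h₁ h₂).trans_eq ?_
  obtain rfl : b = 1 - a := by linarith
  unfold lambdaFun
  ring

lemma strictMonoOn_lambdaQ {q n : ℕ} (hq : 2 ≤ q) (hn : 2 ≤ n) :
    StrictMonoOn (fun ω => lambdaQ q ω n) (Icc (0 : ℝ) (((q : ℝ) - 1) / q)) := by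
  intro x hx y hy hxy
  have hmax := lambdaQ_of_ge (n := n) hq (by omega) (le_refl (((q : ℝ) - 1) / q))
  have hlt := lambdaQ_lt hq hn hx.1 (hxy.trans_le hy.2)
  rcases hy.2.eq_or_lt with rfl | hy'
  · exact hlt.trans_eq hmax.symm
  · refine (concaveOn_lambdaQ n hq).left_lt_of_lt_right hx.1 (hy.1.trans hy.2) ?_
      ((lambdaQ_lt hq hn hy.1 hy').trans_eq hmax.symm)
    rw [openSegment_eq_Ioo (hxy.trans hy')]
    exact ⟨hxy, hy'⟩

/-- Example (the `[n, n-1, 2]` parity code): (i) its weight enumerator is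
`(1/q)·[(1+(q-1)z)^n + (q-1)(1-z)^n]`; (ii) `(1/n)·log_q α_𝒞(ω) = λ_q(ω,n)`; and
(iii) `ω ↦ λ_q(ω,n)` is `0` at `ω = 0`, strictly increasing on `[0,(q-1)/q]`, equal to
`(n-1)/n` at `ω = (q-1)/q`, and constantly `(n-1)/n` for `ω ≥ (q-1)/q`. -/
theorem parity_code_weight_enum
    (K : Type) [Field K] [Fintype K] [DecidableEq K]
    (q : ℕ) (hq : Fintype.card K = q)
    (n : ℕ) (hn : 2 ≤ n)
    (Cc : Submodule K (Fin n → K))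
    (hCc : ∀ x : Fin n → K, x ∈ Cc ↔ (∑ i, x i) = 0) :
    -- (i) the weight enumerator of the parity code
    (∀ z : ℝ, weightEnum n Cc z =
      (1 / (q : ℝ)) * ((1 + ((q:ℝ) - 1) * z) ^ n + ((q:ℝ) - 1) * (1 - z) ^ n)) ∧
    -- (ii) `(1/n)·log_q α_𝒞(ω) = λ_q(ω,n)`
    (∀ ω : ℝ, 0 ≤ ω → (1 / (n : ℝ)) * Real.logb q (alphaC n Cc ω) = lambdaQ q ω n) ∧
    -- (iii) behaviour of `ω ↦ λ_q(ω,n)`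
    lambdaQ q 0 n = 0 ∧
    StrictMonoOn (fun ω => lambdaQ q ω n) (Set.Icc (0:ℝ) (((q:ℝ) - 1) / q)) ∧
    lambdaQ q (((q:ℝ) - 1) / q) n = ((n:ℝ) - 1) / n ∧
    (∀ ω : ℝ, ((q:ℝ) - 1) / q ≤ ω → lambdaQ q ω n = ((n:ℝ) - 1) / n) := by
  have hq2 : 2 ≤ q := hq ▸ Fintype.one_lt_card
  have hn0 : n ≠ 0 := by omega
  have hW (z : ℝ) : weightEnum n Cc z = 1 / (q : ℝ) * parityNum q n z := by
    classical
    rw [weightEnum_eq_sum]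
    simp only [hCc, sum_pow_hammingNorm_of_sum_eq, hq, if_true, parityNum]
  refine ⟨hW, fun ω hω => ?_, lambdaQ_zero n hq2, strictMonoOn_lambdaQ hq2 hn,
    lambdaQ_of_ge hq2 hn0 le_rfl, fun ω hω => lambdaQ_of_ge hq2 hn0 hω⟩
  simp only [alphaC, hW]
  exact logb_iInf_eq hq2 hn0 hω
end
end
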